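/- arXiv:1501.05021 — 2 statements merged into one kernel-verified Lean document; each statement's English description precedes it below -/
import Mathlib

section
/- Let M be a random symmetric n×n matrix with zero diagonal whose entries above the diagonal are independent, with M_ij = 1 − p_ij with probability p_ij and M_ij = −p_ij with probability 1 − p_ij, and suppose p_ij ≤ σ² for all i,j. Let M₁ be obtained from M by zeroing out all rows and columns of M having more than 20·σ²·n positive entries. Then there is an absolute constant C > 0 such that with probability 1 − o(1), the operator norm satisfies ‖M₁‖ ≤ C·σ·√n. -/
open MeasureTheory Filter Finset

/-- The Bernoulli measure on `Bool` with success probability `p` (clamped to `[0,1]`). -/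
noncomputable def bern (p : ℝ) : Measure Bool :=
  (PMF.bernoulli (min (Real.toNNReal p) 1) (min_le_right _ _)).toMeasure

instance (p : ℝ) : IsProbabilityMeasure (bern p) := by
  unfold bern; infer_instance

/-- Index set for the unordered pairs of distinct vertices of `Fin N`. -/
abbrev EdgeIdx (N : ℕ) := {e : Fin N × Fin N // e.1 < e.2}

/-- A configuration of edges: which unordered pairs form an edge. -/
abbrev Config (N : ℕ) := EdgeIdx N → Bool

/-- A colored configuration: for every pair, (edge present, edge Red). For the censor
block model the second component is instead the noise bit of the pair. -/
abbrev CConfig (N : ℕ) := EdgeIdx N → Bool × Bool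

/-- Adjacency relation of the graph determined by a configuration. -/
def adjOf {N : ℕ} (ω : Config N) (i j : Fin N) : Bool :=
  if h : i < j then ω ⟨(i, j), h⟩ else if h : j < i then ω ⟨(j, i), h⟩ else false

/-- Degree of a vertex in the graph determined by a configuration. -/
def degOf {N : ℕ} (ω : Config N) (v : Fin N) : ℕ :=
  (univ.filter fun j => adjOf ω v j).card

/-- The two-block stochastic block model `SBM(n,a,b)` on `2*n` vertices: within-block
pairs are edges with probability `a/n`, cross-block pairs with probability `b/n`,
independently. -/
noncomputable def sbm2 (n : ℕ) (a b : ℝ) : Measure (Config (2 * n)) :=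
  Measure.pi fun e =>
    bern (if ((e.1.1 : ℕ) < n ↔ (e.1.2 : ℕ) < n) then a / n else b / n)

/-- The first block `V₁` (the first `n` vertices). -/
def block1 (n : ℕ) : Finset (Fin (2 * n)) := univ.filter fun i => (i : ℕ) < n

/-- The second block `V₂` (the last `n` vertices). -/
def block2 (n : ℕ) : Finset (Fin (2 * n)) := univ.filter fun i => ¬ (i : ℕ) < n

/-- `(V₁', V₂')` is `γ`-correct: `|Vᵢ ∩ Vᵢ'| ≥ (1-γ)n` for `i = 1,2`. -/
def correct2 (n : ℕ) (γ : ℝ) (P : Finset (Fin (2 * n)) × Finset (Fin (2 * n))) : Prop :=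
  (1 - γ) * (n : ℝ) ≤ ((block1 n ∩ P.1).card : ℝ) ∧
  (1 - γ) * (n : ℝ) ≤ ((block2 n ∩ P.2).card : ℝ)

/-- A pair of disjoint subsets partitioning the vertex set. -/
def isPartition2 {N : ℕ} (P : Finset (Fin N) × Finset (Fin N)) : Prop :=
  Disjoint P.1 P.2 ∧ P.1 ∪ P.2 = univ

/-- Expected adjacency matrix of `SBM(n,a,b)`. -/
noncomputable def expAdj (n : ℕ) (a b : ℝ) : Matrix (Fin (2 * n)) (Fin (2 * n)) ℝ :=
  fun i j => if i = j then 0 else if ((i : ℕ) < n ↔ (j : ℕ) < n) then a / n else b / n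

/-- Adjacency matrix (over `ℝ`) of the graph determined by a configuration. -/
noncomputable def adjMat {N : ℕ} (ω : Config N) : Matrix (Fin N) (Fin N) ℝ :=
  fun i j => if adjOf ω i j then 1 else 0

/-- Zero out all rows and columns corresponding to vertices of degree `> 20 d`. -/
noncomputable def zeroOutHighDeg {N : ℕ} (d : ℝ) (ω : Config N)
    (M : Matrix (Fin N) (Fin N) ℝ) : Matrix (Fin N) (Fin N) ℝ :=
  fun i j => if 20 * d < (degOf ω i : ℝ) ∨ 20 * d < (degOf ω j : ℝ) then 0 else M i j

/-- The spectral (ℓ² operator) norm of a real square matrix. -/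
noncomputable def opNorm {N : ℕ} (M : Matrix (Fin N) (Fin N) ℝ) : ℝ :=
  ‖LinearMap.toContinuousLinearMap (Matrix.toEuclideanLin M)‖

/-- The orthogonal projection onto a subspace, as an endomorphism. -/
noncomputable def projCLM {N : ℕ} (W : Submodule ℝ (EuclideanSpace ℝ (Fin N))) :
    EuclideanSpace ℝ (Fin N) →L[ℝ] EuclideanSpace ℝ (Fin N) :=
  W.subtypeL.comp (Submodule.orthogonalProjectionOnto W)

/-- `sin ∠(W₁, W₂) := ‖P_{W₁} - P_{W₂}‖`. -/
noncomputable def sinAngle {N : ℕ} (W₁ W₂ : Submodule ℝ (EuclideanSpace ℝ (Fin N))) : ℝ :=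
  ‖projCLM W₁ - projCLM W₂‖

/-- Build a vector of `EuclideanSpace ℝ (Fin N)` from its coordinates. -/
noncomputable def mkVec {N : ℕ} (f : Fin N → ℝ) : EuclideanSpace ℝ (Fin N) :=
  (EuclideanSpace.equiv (Fin N) ℝ).symm f

/-- `W` is the eigenspace corresponding to the top two eigenvalues of the symmetric
matrix `M`: it is spanned by two orthonormal eigenvectors whose eigenvalues dominate
every eigenvalue attained on `Wᗮ`. -/
def IsTopTwoSpace {N : ℕ} (M : Matrix (Fin N) (Fin N) ℝ)
    (W : Submodule ℝ (EuclideanSpace ℝ (Fin N))) : Prop :=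
  ∃ (u₁ u₂ : EuclideanSpace ℝ (Fin N)) (μ₁ μ₂ : ℝ),
    (inner ℝ u₁ u₂ : ℝ) = 0 ∧ ‖u₁‖ = 1 ∧ ‖u₂‖ = 1 ∧
    W = Submodule.span ℝ {u₁, u₂} ∧
    Matrix.toEuclideanLin M u₁ = μ₁ • u₁ ∧
    Matrix.toEuclideanLin M u₂ = μ₂ • u₂ ∧
    ∀ (μ : ℝ) (v : EuclideanSpace ℝ (Fin N)), v ≠ 0 → v ∈ Wᗮ →
      Matrix.toEuclideanLin M v = μ • v → μ ≤ min μ₁ μ₂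

/-- `P` is a possible output of the **Spectral Partition** algorithm run on the
configuration `ω` with degree parameter `d`. -/
def IsSpectralOutput (n : ℕ) (ω : Config (2 * n)) (d : ℝ)
    (P : Finset (Fin (2 * n)) × Finset (Fin (2 * n))) : Prop :=
  ∃ (W : Submodule ℝ (EuclideanSpace ℝ (Fin (2 * n))))
    (v : EuclideanSpace ℝ (Fin (2 * n))),
    IsTopTwoSpace (zeroOutHighDeg d ω (adjMat ω)) W ∧
    v ∈ W ∧ ‖v‖ = 1 ∧ (inner ℝ (projCLM W (mkVec fun _ => 1)) v : ℝ) = 0 ∧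
    P.1.card = n ∧ P.2 = P.1ᶜ ∧ ∀ i ∈ P.1, ∀ j ∈ P.2, v j ≤ v i

/-- The two-block SBM together with an independent fair Red/Blue coloring of each edge:
first component = edge present, second component = edge colored Red. -/
noncomputable def sbm2c (n : ℕ) (a b : ℝ) : Measure (CConfig (2 * n)) :=
  Measure.pi fun e =>
    (bern (if ((e.1.1 : ℕ) < n ↔ (e.1.2 : ℕ) < n) then a / n else b / n)).prod
      (bern (1 / 2))

/-- The Red subgraph of a colored configuration. -/
def redConf {N : ℕ} (ω : CConfig N) : Config N := fun e => (ω e).1 && (ω e).2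

/-- The Blue subgraph of a colored configuration. -/
def blueConf {N : ℕ} (ω : CConfig N) : Config N := fun e => (ω e).1 && !(ω e).2

/-- Number of Blue neighbors of `u` inside `S`. -/
noncomputable def blueDegIn {N : ℕ} (ω : CConfig N) (S : Finset (Fin N)) (u : Fin N) : ℕ :=
  (S.filter fun v => adjOf (blueConf ω) u v).card

/-- Number of Red neighbors of `u` inside `S`. -/
noncomputable def redDegIn {N : ℕ} (ω : CConfig N) (S : Finset (Fin N)) (u : Fin N) : ℕ :=
  (S.filter fun v => adjOf (redConf ω) u v).card

/-- The **Correction** subroutine with threshold `t`: a vertex of `P.i` is bad if it has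
at least `t` Blue neighbors in the other class; bad vertices are moved to the other side. -/
noncomputable def corrected2 {N : ℕ} (t : ℝ) (ω : CConfig N)
    (P : Finset (Fin N) × Finset (Fin N)) : Finset (Fin N) × Finset (Fin N) :=
  let bad1 := P.1.filter fun u => t ≤ (blueDegIn ω P.2 u : ℝ)
  let bad2 := P.2.filter fun u => t ≤ (blueDegIn ω P.1 u : ℝ)
  ((P.1 \ bad1) ∪ bad2, (P.2 \ bad2) ∪ bad1)

/-- The `k`-block SBM on `k*m` vertices (`k` blocks of size `m`, so `n = k*m` total
vertices and edge probabilities `a/n` within blocks and `b/n` across). -/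
noncomputable def sbmK (k m : ℕ) (a b : ℝ) : Measure (Config (k * m)) :=
  Measure.pi fun e =>
    bern (if (e.1.1 : ℕ) / m = (e.1.2 : ℕ) / m then a / (k * m) else b / (k * m))

/-- The `i`-th block `Vᵢ` (of size `m = n/k`). -/
def blockK (k m : ℕ) (i : Fin k) : Finset (Fin (k * m)) :=
  univ.filter fun v => (v : ℕ) / m = (i : ℕ)

/-- The subset `Z` selected by the splitting coins `s` (its complement is `Y`). -/
def Zset {N : ℕ} (s : Fin N → Bool) : Finset (Fin N) := univ.filter fun v => s v = true

/-- The `k`-block SBM together with a uniformly random split of the vertices. -/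
noncomputable def sbmKs (k m : ℕ) (a b : ℝ) :
    Measure ((Fin (k * m) → Bool) × Config (k * m)) :=
  (Measure.pi fun _ : Fin (k * m) => bern (1 / 2)).prod (sbmK k m a b)

/-- The `k`-block SBM together with a uniformly random split of the vertices and an
independent fair Red/Blue coloring of each edge. -/
noncomputable def sbmKsc (k m : ℕ) (a b : ℝ) :
    Measure ((Fin (k * m) → Bool) × CConfig (k * m)) :=
  (Measure.pi fun _ : Fin (k * m) => bern (1 / 2)).prod
    (Measure.pi fun e : EdgeIdx (k * m) =>
      (bern (if (e.1.1 : ℕ) / m = (e.1.2 : ℕ) / m then a / (k * m) else b / (k * m))).prod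
        (bern (1 / 2)))

/-- `U` is a `γ`-correct partition of `Z = (V₁ ∩ Z) ∪ ... ∪ (V_k ∩ Z)`:
a collection of disjoint subsets of `Z` covering `Z` with
`|(Vᵢ ∩ Z) ∩ Uᵢ| ≥ (1-γ)|Vᵢ ∩ Z|` for every `i`. -/
def correctOnZ (k m : ℕ) (γ : ℝ) (s : Fin (k * m) → Bool)
    (U : Fin k → Finset (Fin (k * m))) : Prop :=
  (∀ i, U i ⊆ Zset s) ∧ (∀ i j, i ≠ j → Disjoint (U i) (U j)) ∧
  (univ.biUnion U = Zset s) ∧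
  ∀ i, (1 - γ) * ((blockK k m i ∩ Zset s).card : ℝ) ≤
    (((blockK k m i ∩ Zset s) ∩ U i).card : ℝ)

/-- Censor block model: for every pair of vertices, an independent pair
(edge present with probability `p`, noise bit with probability `ε`). -/
noncomputable def cbmMeasure (n : ℕ) (p ε : ℝ) : Measure (CConfig (2 * n)) :=
  Measure.pi fun _ => (bern p).prod (bern ε)

/-- The observation `y = B_G x ⊕ z` of the censor block model: for each present edge
`(i,j)` one observes `x_i ⊕ x_j ⊕ z_e` (where `x` is the indicator of the second
block); nothing is observed on absent edges. -/
def cbmObs (n : ℕ) (ω : CConfig (2 * n)) (e : EdgeIdx (2 * n)) : Option Bool :=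
  if (ω e).1 then
    some (xor (xor (decide ((e.1.1 : ℕ) < n)) (decide ((e.1.2 : ℕ) < n))) (ω e).2)
  else none

/-- `e(S,T)`: adjacency-matrix count of edges between `S` and `T` in a simple graph. -/
def eCount {n : ℕ} (G : SimpleGraph (Fin n)) [DecidableRel G.Adj]
    (S T : Finset (Fin n)) : ℝ :=
  ∑ i ∈ S, ∑ j ∈ T, if G.Adj i j then 1 else 0

/-- `e(S,T)` for the graph of a configuration. -/
def eCountC {n : ℕ} (ω : Config n) (S T : Finset (Fin n)) : ℝ :=
  ∑ i ∈ S, ∑ j ∈ T, if adjOf ω i j then 1 else 0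

/-- The random symmetric matrix model: independent edges, pair `(i,j)` present with
probability `p i j`. -/
noncomputable def genMeasure {n : ℕ} (p : Fin n → Fin n → ℝ) : Measure (Config n) :=
  Measure.pi fun e => bern (p e.1.1 e.1.2)

/-- The centered matrix `M` with `M_ij = 1 - p_ij` if the pair is present and
`M_ij = -p_ij` otherwise, and zero diagonal. -/
noncomputable def centeredMat {n : ℕ} (p : Fin n → Fin n → ℝ) (ω : Config n) :
    Matrix (Fin n) (Fin n) ℝ :=
  fun i j => if i = j then 0 else (if adjOf ω i j then 1 else 0) - p i j

/-- Number of positive entries in row `i` of `M`. -/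
noncomputable def posRowCount {n : ℕ} (M : Matrix (Fin n) (Fin n) ℝ) (i : Fin n) : ℕ :=
  (univ.filter fun j => 0 < M i j).card

/-- Zero out the rows and columns indexed by `S`. -/
noncomputable def zeroOutRows {n : ℕ} (S : Finset (Fin n)) (M : Matrix (Fin n) (Fin n) ℝ) :
    Matrix (Fin n) (Fin n) ℝ :=
  fun i j => if i ∈ S ∨ j ∈ S then 0 else M i j

/-- The all-ones direction `v̄₁` (unit vector). -/
noncomputable def vbar1 (n : ℕ) : EuclideanSpace ℝ (Fin (2 * n)) :=
  mkVec fun _ => 1 / Real.sqrt (2 * n)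

/-- The block-indicator direction `v̄₂` (unit vector). -/
noncomputable def vbar2 (n : ℕ) : EuclideanSpace ℝ (Fin (2 * n)) :=
  mkVec fun i =>
    if (i : ℕ) < n then 1 / Real.sqrt (2 * n) else -(1 / Real.sqrt (2 * n))

instance {n : ℕ} (p : Fin n → Fin n → ℝ) : IsProbabilityMeasure (genMeasure p) := by
  unfold genMeasure; infer_instance

theorem integral_bern {q : ℝ} (h0 : 0 ≤ q) (h1 : q ≤ 1) (f : Bool → ℝ) :
    ∫ b, f b ∂bern q = q * f true + (1 - q) * f false := by
  have hq' : (Real.toNNReal q) ≤ 1 := by simpa using h1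
  unfold bern
  rw [PMF.integral_eq_sum]
  simp [PMF.bernoulli_apply, hq', h0]

/-- Chernoff bound for weighted edge counts. -/
theorem genMeasure_real_le_exp {n : ℕ} {p : Fin n → Fin n → ℝ} (h0 : ∀ i j, 0 ≤ p i j)
    (h1 : ∀ i j, p i j ≤ 1) (c : EdgeIdx n → ℝ) (t : ℝ) :
    (genMeasure p).real {ω | t ≤ ∑ e, c e * (if ω e then 1 else 0)} ≤
      Real.exp (-t + ∑ e : EdgeIdx n, p e.1.1 e.1.2 * (Real.exp (c e) - 1)) := by
  have hI : ∫ ω, Real.exp (∑ e, c e * (if ω e then 1 else 0)) ∂genMeasure p ≤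
      Real.exp (∑ e : EdgeIdx n, p e.1.1 e.1.2 * (Real.exp (c e) - 1)) := by
    simp_rw [Real.exp_sum]
    unfold genMeasure
    rw [integral_fintype_prod_eq_prod (fun e (b : Bool) => Real.exp (c e * if b then 1 else 0))]
    refine Finset.prod_le_prod (fun e _ => integral_nonneg fun _ => (Real.exp_pos _).le)
      fun e _ => ?_
    rw [integral_bern (h0 _ _) (h1 _ _)]
    have := Real.add_one_le_exp (p e.1.1 e.1.2 * (Real.exp (c e) - 1))
    simp
    linarith
  have hM := mul_meas_ge_le_integral_of_nonneg (μ := genMeasure p)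
    (f := fun ω => Real.exp (∑ e, c e * (if ω e then 1 else 0)))
    (ae_of_all _ fun _ => (Real.exp_pos _).le) .of_finite (Real.exp t)
  simp only [Real.exp_le_exp] at hM
  rw [Real.exp_add, Real.exp_neg, ← div_eq_inv_mul, le_div_iff₀' (Real.exp_pos _)]
  exact hM.trans hI

theorem adjMat_symm {n : ℕ} (ω : Config n) (i j : Fin n) : adjMat ω i j = adjMat ω j i := by
  unfold adjMat adjOf
  rcases lt_trichotomy i j with h | h | h
  · simp [h, h.not_gt]
  · simp [h]
  · simp [h, h.not_gt]

theorem adjMat_self {n : ℕ} (ω : Config n) (i : Fin n) : adjMat ω i i = 0 := by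
  simp [adjMat, adjOf]

theorem adjMat_edge {n : ℕ} (ω : Config n) (e : EdgeIdx n) :
    adjMat ω e.1.1 e.1.2 = if ω e then 1 else 0 := by
  simp [adjMat, adjOf, e.2]

theorem adjMat_nonneg {n : ℕ} (ω : Config n) (i j : Fin n) : 0 ≤ adjMat ω i j := by
  unfold adjMat; split_ifs <;> norm_num

theorem sum_sum_eq_sum_edges {n : ℕ} (g : Fin n → Fin n → ℝ) (hg : ∀ i, g i i = 0) :
    ∑ i, ∑ j, g i j = ∑ e : EdgeIdx n, (g e.1.1 e.1.2 + g e.1.2 e.1.1) := by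
  have h2 : ∑ i, ∑ j, g i j = ∑ i, ∑ j, ((if i < j then g i j else 0) +
      (if j < i then g i j else 0)) := by
    refine sum_congr rfl fun i _ => sum_congr rfl fun j _ => ?_
    rcases lt_trichotomy i j with h | h | h
    · simp [h, h.not_gt]
    · simp [h, hg]
    · simp [h, h.not_gt]
  have h3 : ∑ e : EdgeIdx n, (g e.1.1 e.1.2 + g e.1.2 e.1.1) =
      ∑ i, ∑ j, if i < j then g i j + g j i else 0 := by
    rw [← Fintype.sum_prod_type', ← Finset.sum_filter]
    exact (Finset.sum_subtype (univ.filter fun e : Fin n × Fin n => e.1 < e.2) (by simp)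
      (fun e => g e.1 e.2 + g e.2 e.1)).symm
  rw [h2, h3]
  simp_rw [sum_add_distrib]
  rw [sum_comm (f := fun i j => if j < i then g i j else 0)]
  simp_rw [← sum_add_distrib]
  refine sum_congr rfl fun i _ => sum_congr rfl fun j _ => ?_
  split_ifs <;> simp

theorem sum_sum_adjMat_mul {n : ℕ} (ω : Config n) (f : Fin n → Fin n → ℝ) :
    ∑ i, ∑ j, adjMat ω i j * f i j =
      ∑ e : EdgeIdx n, (f e.1.1 e.1.2 + f e.1.2 e.1.1) * (if ω e then 1 else 0) := by
  rw [sum_sum_eq_sum_edges _ (by simp [adjMat_self])]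
  refine sum_congr rfl fun e _ => ?_
  rw [adjMat_symm ω e.1.2 e.1.1, adjMat_edge]; ring

theorem sum_pow_four_le (N : ℕ) {Q : ℝ} (hQ : 0 ≤ Q) :
    ∑ a ∈ range N, (if (4 : ℝ) ^ a ≤ Q then (4 : ℝ) ^ a else 0) ≤ 2 * Q := by
  induction N with
  | zero => simpa using hQ
  | succ N ih =>
    by_cases h : (4 : ℝ) ^ N ≤ Q
    · have h1 : ∀ N : ℕ, ∑ a ∈ range (N + 1), (4 : ℝ) ^ a ≤ 2 * 4 ^ N := by
        intro N
        induction N with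
        | zero => norm_num
        | succ N ih =>
          rw [sum_range_succ, pow_succ]
          have : (0 : ℝ) < 4 ^ N := by positivity
          linarith
      calc _ ≤ ∑ a ∈ range (N + 1), (4 : ℝ) ^ a := by
            refine sum_le_sum fun a _ => ?_
            split_ifs
            · exact le_rfl
            · positivity
        _ ≤ 2 * 4 ^ N := h1 N
        _ ≤ _ := by linarith
    · rw [sum_range_succ, if_neg h, add_zero]; exact ih

theorem sum_inv_two_pow_le (N : ℕ) : ∑ b ∈ range N, ((2 : ℝ) ^ b)⁻¹ ≤ 2 := by
  simpa using sum_geometric_two_le N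

/-- The summable majorant of the contribution of a pair of level sets. -/
noncomputable def levelBound (n D ξ η : ℝ) (a b : ℕ) : ℝ :=
  D * ξ * η / n + η * (if (4 : ℝ) ^ a ≤ 4 * D * 4 ^ b then (4 : ℝ) ^ a else 0) / 4 ^ b
    + D * ξ / 2 ^ b + n * (if (4 : ℝ) ^ a ≤ D then (4 : ℝ) ^ a else 0) / 2 ^ b

theorem levelBound_nonneg {n D ξ η : ℝ} (hn : 0 < n) (hD : 0 < D) (hξ : 0 ≤ ξ) (hη : 0 ≤ η)
    (a b : ℕ) : 0 ≤ levelBound n D ξ η a b := by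
  unfold levelBound
  have h1 : (0 : ℝ) ≤ if (4 : ℝ) ^ a ≤ 4 * D * 4 ^ b then (4 : ℝ) ^ a else 0 := by
    split_ifs <;> positivity
  have h2 : (0 : ℝ) ≤ if (4 : ℝ) ^ a ≤ D then (4 : ℝ) ^ a else 0 := by
    split_ifs <;> positivity
  positivity

theorem sum_levelBound_le {n D : ℝ} (hn : 0 < n) (hD : 0 < D) {ξ η : ℕ → ℝ}
    (hη : ∀ a, 0 ≤ η a) {N : ℕ} (hξs : ∑ a ∈ range N, ξ a ≤ 16 * n)
    (hηs : ∑ a ∈ range N, η a ≤ 16 * n) :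
    ∑ a ∈ range N, ∑ b ∈ range N, levelBound n D (ξ a) (η b) a b ≤ 420 * n * D := by
  have e1 : ∑ a ∈ range N, ∑ b ∈ range N, D * ξ a * η b / n ≤ 256 * n * D := by
    have : ∑ a ∈ range N, ∑ b ∈ range N, D * ξ a * η b / n =
        D / n * ((∑ a ∈ range N, ξ a) * ∑ b ∈ range N, η b) := by
      rw [sum_mul_sum, mul_sum]
      refine sum_congr rfl fun a _ => ?_
      rw [mul_sum]
      exact sum_congr rfl fun b _ => by ring
    rw [this]
    calc _ ≤ D / n * ((16 * n) * (16 * n)) := by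
          gcongr
          exact sum_nonneg fun b _ => hη b
      _ = _ := by field_simp; norm_num
  have e2 : ∑ a ∈ range N, ∑ b ∈ range N,
      η b * (if (4 : ℝ) ^ a ≤ 4 * D * 4 ^ b then (4 : ℝ) ^ a else 0) / 4 ^ b ≤ 128 * n * D := by
    rw [sum_comm]
    calc _ = ∑ b ∈ range N, η b / 4 ^ b *
          ∑ a ∈ range N, (if (4 : ℝ) ^ a ≤ 4 * D * 4 ^ b then (4 : ℝ) ^ a else 0) := by
          refine sum_congr rfl fun b _ => ?_
          rw [mul_sum]
          exact sum_congr rfl fun a _ => by ring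
      _ ≤ ∑ b ∈ range N, η b / 4 ^ b * (2 * (4 * D * 4 ^ b)) := by
          refine sum_le_sum fun b _ => ?_
          have := hη b
          gcongr
          exact sum_pow_four_le N (by positivity)
      _ = (∑ b ∈ range N, η b) * (8 * D) := by
          rw [sum_mul]
          refine sum_congr rfl fun b _ => ?_
          field_simp; ring
      _ ≤ 16 * n * (8 * D) := by gcongr
      _ = _ := by ring
  have e3 : ∑ a ∈ range N, ∑ b ∈ range N, D * ξ a / 2 ^ b ≤ 32 * n * D := by
    have : ∑ a ∈ range N, ∑ b ∈ range N, D * ξ a / 2 ^ b =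
        D * ((∑ a ∈ range N, ξ a) * ∑ b ∈ range N, ((2 : ℝ) ^ b)⁻¹) := by
      rw [sum_mul_sum, mul_sum]
      refine sum_congr rfl fun a _ => ?_
      rw [mul_sum]
      exact sum_congr rfl fun b _ => by ring
    rw [this]
    calc _ ≤ D * ((16 * n) * 2) := by
          gcongr
          exact sum_inv_two_pow_le N
      _ = _ := by ring
  have e4 : ∑ a ∈ range N, ∑ b ∈ range N,
      n * (if (4 : ℝ) ^ a ≤ D then (4 : ℝ) ^ a else 0) / 2 ^ b ≤ 4 * n * D := by
    have : ∑ a ∈ range N, ∑ b ∈ range N,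
        n * (if (4 : ℝ) ^ a ≤ D then (4 : ℝ) ^ a else 0) / 2 ^ b =
        n * ((∑ a ∈ range N, if (4 : ℝ) ^ a ≤ D then (4 : ℝ) ^ a else 0) *
          ∑ b ∈ range N, ((2 : ℝ) ^ b)⁻¹) := by
      rw [sum_mul_sum, mul_sum]
      refine sum_congr rfl fun a _ => ?_
      rw [mul_sum]
      exact sum_congr rfl fun b _ => by ring
    rw [this]
    calc _ ≤ n * ((2 * D) * 2) := by
          gcongr
          · exact sum_pow_four_le N hD.le
          · exact sum_inv_two_pow_le N
      _ = _ := by ring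
  unfold levelBound
  simp_rw [sum_add_distrib]
  linarith

theorem mul_pow_le_levelBound {n D x y e : ℝ} {a b : ℕ} (hn : 0 < n) (hD : 0 < D) (hx : 0 < x)
    (hy : 0 < y) (hyn : y ≤ n) (he : 0 ≤ e) (hy16 : y * 16 ^ b ≤ 16 * n)
    (hab : (4 : ℝ) ^ a ≤ 4 * D * 4 ^ b) (hD' : D ≤ 16 * 4 ^ (a + b))
    (hdisc : e ≤ Real.exp 4 * (D ^ 2 / n * x * y) ∨
      e * Real.log (e / (D ^ 2 / n * x * y)) ≤ 32 * (y * Real.log (Real.exp 1 * n / y))) :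
    e * 4 ^ (a + b) ≤ 2048 * levelBound n D (x * 16 ^ a) (y * 16 ^ b) a b := by
  have hexp1 : Real.exp 1 ≤ 3 := Real.exp_one_lt_three.le
  have hexp4 : Real.exp 4 ≤ 81 := by
    have : Real.exp 4 = Real.exp 1 ^ 4 := by rw [← Real.exp_nat_mul]; norm_num
    rw [this]
    calc _ ≤ (3 : ℝ) ^ 4 := by gcongr
      _ = _ := by norm_num
  have s4a : (16 : ℝ) ^ a = 4 ^ a * 4 ^ a := by rw [← mul_pow]; norm_num
  have s4b : (16 : ℝ) ^ b = 4 ^ b * 4 ^ b := by rw [← mul_pow]; norm_num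
  have s2b : (4 : ℝ) ^ b = 2 ^ b * 2 ^ b := by rw [← mul_pow]; norm_num
  rw [pow_add] at hD' ⊢
  have e2 : (0 : ℝ) ≤ if (4 : ℝ) ^ a ≤ D then (4 : ℝ) ^ a else 0 := by
    split_ifs <;> positivity
  unfold levelBound
  rw [if_pos hab]
  set P : ℝ := 4 ^ a with hP
  set R : ℝ := 2 ^ b with hR
  have hP0 : 0 < P := by positivity
  have hR0 : 0 < R := by positivity
  rw [s4b, s2b] at hy16
  rw [s4a, s4b, s2b]
  rw [s2b] at hD' hab
  set I : ℝ := if P ≤ D then P else 0 with hI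
  have t1 : 0 ≤ D * (x * (P * P)) * (y * (R * R * (R * R))) / n := by positivity
  have t2 : 0 ≤ y * (R * R * (R * R)) * P / (R * R) := by positivity
  have t3 : 0 ≤ D * (x * (P * P)) / R := by positivity
  have t4 : 0 ≤ n * I / R := by positivity
  by_cases h1 : e ≤ Real.exp 4 * (D ^ 2 / n * x * y)
  · have : e * (P * (R * R)) ≤ 2048 * (D * (x * (P * P)) * (y * (R * R * (R * R))) / n) := by
      calc e * (P * (R * R)) ≤ 81 * (D ^ 2 / n * x * y) * (P * (R * R)) := by
            gcongr
            refine h1.trans ?_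
            gcongr
        _ = 81 * (D / n * x * y) * (P * (R * R)) * D := by ring
        _ ≤ 81 * (D / n * x * y) * (P * (R * R)) * (16 * (P * (R * R))) := by gcongr
        _ = 1296 * (D * (x * (P * P)) * (y * (R * R * (R * R))) / n) := by ring
        _ ≤ _ := by gcongr; norm_num
    linarith
  have h2 := hdisc.resolve_left h1
  push Not at h1
  set μ := D ^ 2 / n * x * y with hμ
  have hμ0 : 0 < μ := by positivity
  set r := e / μ with hr
  have her : e = r * μ := by rw [hr]; field_simp
  have hr4 : Real.exp 4 < r := by rw [hr, lt_div_iff₀ hμ0]; exact h1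
  have hr0 : 0 < r := (Real.exp_pos _).trans hr4
  have hlr : 4 < Real.log r := by rwa [Real.lt_log_iff_exp_lt hr0]
  set L := Real.log (Real.exp 1 * n / y) with hL
  have hL1 : 1 ≤ L := by
    rw [hL, Real.le_log_iff_exp_le (by positivity), le_div_iff₀ hy]
    gcongr
  by_cases h3 : L / 4 ≤ Real.log r
  · have he' : e ≤ 128 * y := by
      have : e * (L / 4) ≤ 32 * (y * L) := (by gcongr : e * (L / 4) ≤ e * Real.log r).trans h2
      nlinarith
    have : e * (P * (R * R)) ≤ 2048 * (y * (R * R * (R * R)) * P / (R * R)) := by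
      calc e * (P * (R * R)) ≤ 128 * y * (P * (R * R)) := by gcongr
        _ = 128 * (y * (R * R * (R * R)) * P / (R * R)) := by field_simp
        _ ≤ _ := by gcongr; norm_num
    linarith
  push Not at h3
  set w := Real.exp (L / 4) with hw
  have hw0 : 0 < w := Real.exp_pos _
  have hrw : r < w := by rwa [hw, ← Real.log_lt_iff_lt_exp hr0]
  have hLw : L ≤ 4 * w := by
    have := Real.add_one_le_exp (L / 4)
    linarith
  have hw4 : w ^ 4 = Real.exp 1 * n / y := by
    rw [hw, ← Real.exp_nat_mul]
    rw [show ((4 : ℕ) : ℝ) * (L / 4) = L by push_cast; ring, hL, Real.exp_log (by positivity)]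
  set η := y * (R * R * (R * R)) with hη
  have hη0 : 0 < η := by positivity
  have hηw : η * w ≤ 16 * n * R := by
    refine le_of_pow_le_pow_left₀ (n := 4) (by norm_num) (by positivity) ?_
    rw [mul_pow, hw4]
    calc η ^ 4 * (Real.exp 1 * n / y) = Real.exp 1 * n * R ^ 4 * η ^ 3 := by
          rw [hη]; field_simp
      _ ≤ 3 * n * R ^ 4 * (16 * n) ^ 3 := by gcongr
      _ = 12288 * (n * R) ^ 4 := by ring
      _ ≤ 65536 * (n * R) ^ 4 := by gcongr; norm_num
      _ = _ := by ring
  by_cases h4 : P ≤ D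
  · have : e * (P * (R * R)) ≤ 2048 * (n * I / R) := by
      have hee : e ≤ 128 * y * w := by
        calc e ≤ e * Real.log r := by nlinarith
          _ ≤ 32 * (y * L) := h2
          _ ≤ 32 * (y * (4 * w)) := by gcongr
          _ = _ := by ring
      rw [hI, if_pos h4]
      calc e * (P * (R * R)) ≤ 128 * y * w * (P * (R * R)) := by gcongr
        _ = 128 * (η * w) * P / (R * R) := by rw [hη]; field_simp
        _ ≤ 128 * (16 * n * R) * P / (R * R) := by gcongr
        _ = _ := by field_simp; norm_num
    linarith
  · push Not at h4
    have : e * (P * (R * R)) ≤ 2048 * (D * (x * (P * P)) / R) := by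
      calc e * (P * (R * R)) = (η * r) * D ^ 2 / n * x * P / (R * R) := by
            rw [her, hμ, hη]; field_simp
        _ ≤ (16 * n * R) * D ^ 2 / n * x * P / (R * R) := by
            have hηr : η * r ≤ 16 * n * R := (by gcongr : η * r ≤ η * w).trans hηw
            gcongr ?_ * D ^ 2 / n * x * P / (R * R)
        _ = 16 * D * x * P / R * D := by field_simp
        _ ≤ 16 * D * x * P / R * P := by gcongr
        _ = 16 * (D * (x * (P * P)) / R) := by ring
        _ ≤ _ := by gcongr; norm_num
    linarith

/-- Every pair of vertex sets either spans at most a constant times `s * #X * #Y` edges, or its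
edge count is controlled by the entropy of the larger set. -/
def DiscrepancyBound {n : ℕ} (s : ℝ) (ω : Config n) : Prop :=
  ∀ X Y : Finset (Fin n), X.Nonempty → #X ≤ #Y →
    eCountC ω X Y ≤ Real.exp 4 * (s * #X * #Y) ∨
      eCountC ω X Y * Real.log (eCountC ω X Y / (s * #X * #Y)) ≤
        32 * (#Y * Real.log (Real.exp 1 * n / #Y))

theorem eCountC_eq_sum_adjMat {n : ℕ} (ω : Config n) (X Y : Finset (Fin n)) :
    eCountC ω X Y = ∑ i ∈ X, ∑ j ∈ Y, adjMat ω i j := rfl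

theorem eCountC_nonneg {n : ℕ} (ω : Config n) (X Y : Finset (Fin n)) : 0 ≤ eCountC ω X Y :=
  sum_nonneg fun _ _ => sum_nonneg fun _ _ => adjMat_nonneg ω _ _

theorem eCountC_comm {n : ℕ} (ω : Config n) (X Y : Finset (Fin n)) :
    eCountC ω X Y = eCountC ω Y X := by
  simp_rw [eCountC_eq_sum_adjMat]
  refine sum_comm.trans ?_
  exact sum_congr rfl fun _ _ => sum_congr rfl fun _ _ => adjMat_symm ω _ _

/-- The indices at which `u` lies in `[4 ^ a, 4 ^ (a + 1))`. -/
def levelSet {n : ℕ} (u : Fin n → ℕ) (a : ℕ) : Finset (Fin n) :=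
  univ.filter fun i => u i ≠ 0 ∧ Nat.log 4 (u i) = a

theorem mem_levelSet {n : ℕ} {u : Fin n → ℕ} {a : ℕ} {i : Fin n} :
    i ∈ levelSet u a ↔ u i ≠ 0 ∧ Nat.log 4 (u i) = a := by
  simp [levelSet]

theorem pow_le_of_mem_levelSet {n : ℕ} {u : Fin n → ℕ} {a : ℕ} {i : Fin n}
    (h : i ∈ levelSet u a) : (4 : ℝ) ^ a ≤ u i := by
  obtain ⟨h0, rfl⟩ := mem_levelSet.1 h
  exact_mod_cast Nat.pow_log_le_self 4 h0

theorem lt_pow_of_mem_levelSet {n : ℕ} {u : Fin n → ℕ} {a : ℕ} {i : Fin n}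
    (h : i ∈ levelSet u a) : (u i : ℝ) < 4 * 4 ^ a := by
  obtain ⟨h0, rfl⟩ := mem_levelSet.1 h
  have := Nat.lt_pow_succ_log_self (b := 4) (by norm_num) (u i)
  rw [pow_succ'] at this
  exact_mod_cast this

theorem sum_card_levelSet_mul_le {n : ℕ} (u : Fin n → ℕ) (N : ℕ) :
    ∑ a ∈ range N, (#(levelSet u a) : ℝ) * 16 ^ a ≤ ∑ i, (u i : ℝ) ^ 2 := by
  have h1 : ∀ a, (#(levelSet u a) : ℝ) * 16 ^ a ≤
      ∑ i, if u i ≠ 0 ∧ Nat.log 4 (u i) = a then (u i : ℝ) ^ 2 else 0 := by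
    intro a
    rw [← sum_filter, ← nsmul_eq_mul]
    refine card_nsmul_le_sum _ _ _ fun i hi => ?_
    calc (16 : ℝ) ^ a = (4 ^ a) ^ 2 := by rw [← pow_mul, mul_comm, pow_mul]; norm_num
      _ ≤ _ := by
        gcongr
        exact pow_le_of_mem_levelSet hi
  refine (sum_le_sum fun a _ => h1 a).trans ?_
  rw [sum_comm]
  refine sum_le_sum fun i _ => ?_
  by_cases h0 : u i = 0
  · simp [h0]
  · simp only [h0, ne_eq, not_false_eq_true, true_and, sum_ite_eq]
    split_ifs
    · exact le_rfl
    · positivity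

theorem eCountC_levelSet_le {n : ℕ} (hn : 0 < n) {D : ℝ} (hD : 0 < D) {ω : Config n}
    (hdisc : DiscrepancyBound (D ^ 2 / n) ω) {X Y : Finset (Fin n)} {a b : ℕ}
    (hX : (#X : ℝ) * 16 ^ a ≤ 16 * n) (hY : (#Y : ℝ) * 16 ^ b ≤ 16 * n)
    (hab : (4 : ℝ) ^ a ≤ 4 * D * 4 ^ b) (hba : (4 : ℝ) ^ b ≤ 4 * D * 4 ^ a)
    (hD' : D ≤ 16 * 4 ^ (a + b)) :
    eCountC ω X Y * 4 ^ (a + b) ≤ 2048 * (levelBound n D (#X * 16 ^ a) (#Y * 16 ^ b) a b +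
      levelBound n D (#Y * 16 ^ b) (#X * 16 ^ a) b a) := by
  have hn' : (0 : ℝ) < n := by exact_mod_cast hn
  have hc : ∀ Z : Finset (Fin n), (#Z : ℝ) ≤ n := fun Z => by
    exact_mod_cast (card_le_univ Z).trans_eq (Fintype.card_fin n)
  have n1 := levelBound_nonneg (ξ := #X * 16 ^ a) (η := #Y * 16 ^ b) hn' hD (by positivity)
    (by positivity) a b
  have n2 := levelBound_nonneg (ξ := #Y * 16 ^ b) (η := #X * 16 ^ a) hn' hD (by positivity)
    (by positivity) b a
  rcases X.eq_empty_or_nonempty with hXe | hXne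
  · rw [hXe] at n1 n2 ⊢
    have : eCountC ω ∅ Y = 0 := by simp [eCountC]
    rw [this]; linarith
  rcases Y.eq_empty_or_nonempty with hYe | hYne
  · rw [hYe] at n1 n2 ⊢
    have : eCountC ω X ∅ = 0 := by simp [eCountC]
    rw [this]; linarith
  have hX0 : (0 : ℝ) < #X := by exact_mod_cast hXne.card_pos
  have hY0 : (0 : ℝ) < #Y := by exact_mod_cast hYne.card_pos
  rcases le_total (#X) (#Y) with h | h
  · have := mul_pow_le_levelBound hn' hD hX0 hY0 (hc Y) (eCountC_nonneg ω X Y) hY hab hD'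
      (hdisc X Y hXne h)
    linarith
  · rw [add_comm a b] at hD' ⊢
    have := mul_pow_le_levelBound hn' hD hY0 hX0 (hc X) (eCountC_nonneg ω Y X) hX hba hD'
      (hdisc Y X hYne h)
    rw [eCountC_comm]
    linarith

theorem sum_comparable_le {n : ℕ} (hn : 0 < n) {D : ℝ} (hD : 0 < D) {ω : Config n}
    (hdisc : DiscrepancyBound (D ^ 2 / n) ω) {u v : Fin n → ℕ}
    (hu : ∑ i, (u i : ℝ) ^ 2 ≤ 16 * n) (hv : ∑ i, (v i : ℝ) ^ 2 ≤ 16 * n) :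
    ∑ i, ∑ j, adjMat ω i j * (if (u i : ℝ) < D * v j ∧ (v j : ℝ) < D * u i ∧ D < u i * v j
      then (u i : ℝ) * v j else 0) ≤ 27525120 * n * D := by
  have hn' : (0 : ℝ) < n := by exact_mod_cast hn
  set N := univ.sup u ⊔ univ.sup v + 1 with hN
  set G : ℕ → ℕ → ℝ := fun a b => if (4 : ℝ) ^ a ≤ 4 * D * 4 ^ b ∧ (4 : ℝ) ^ b ≤ 4 * D * 4 ^ a ∧
    D ≤ 16 * 4 ^ (a + b) then 16 * 4 ^ (a + b) else 0 with hG
  have hG0 : ∀ a b, 0 ≤ G a b := fun a b => by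
    simp only [hG]; split_ifs <;> positivity
  have hpt : ∀ i j, adjMat ω i j * (if (u i : ℝ) < D * v j ∧ (v j : ℝ) < D * u i ∧ D < u i * v j
      then (u i : ℝ) * v j else 0) ≤ ∑ a ∈ range N, ∑ b ∈ range N,
        G a b * (if i ∈ levelSet u a then (if j ∈ levelSet v b then adjMat ω i j else 0) else 0) := by
    intro i j
    have hterm : ∀ a b, 0 ≤ G a b *
        (if i ∈ levelSet u a then (if j ∈ levelSet v b then adjMat ω i j else 0) else 0) := by
      intro a b
      refine mul_nonneg (hG0 a b) ?_
      split_ifs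
      exacts [adjMat_nonneg ω i j, le_rfl, le_rfl]
    split_ifs with h
    · obtain ⟨h1, h2, h3⟩ := h
      have hui : u i ≠ 0 := by
        rintro h0; rw [h0] at h3; simp at h3; linarith
      have hvj : v j ≠ 0 := by
        rintro h0; rw [h0] at h3; simp at h3; linarith
      have hi : i ∈ levelSet u (Nat.log 4 (u i)) := mem_levelSet.2 ⟨hui, rfl⟩
      have hj : j ∈ levelSet v (Nat.log 4 (v j)) := mem_levelSet.2 ⟨hvj, rfl⟩
      have hiN : Nat.log 4 (u i) ∈ range N := by
        have := Finset.le_sup (f := u) (mem_univ i)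
        have := Nat.log_le_self 4 (u i)
        rw [mem_range]; omega
      have hjN : Nat.log 4 (v j) ∈ range N := by
        have := Finset.le_sup (f := v) (mem_univ j)
        have := Nat.log_le_self 4 (v j)
        rw [mem_range]; omega
      refine le_trans ?_ (single_le_sum (fun a _ => sum_nonneg fun b _ => hterm a b) hiN)
      refine le_trans ?_ (single_le_sum (fun b _ => hterm _ b) hjN)
      rw [if_pos hi, if_pos hj]
      have a1 := pow_le_of_mem_levelSet hi
      have a2 := (lt_pow_of_mem_levelSet hi).le
      have b1 := pow_le_of_mem_levelSet hj
      have b2 := (lt_pow_of_mem_levelSet hj).le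
      have huv : (u i : ℝ) * v j ≤ 16 * 4 ^ (Nat.log 4 (u i) + Nat.log 4 (v j)) := by
        calc (u i : ℝ) * v j ≤ (4 * 4 ^ Nat.log 4 (u i)) * (4 * 4 ^ Nat.log 4 (v j)) := by gcongr
          _ = _ := by rw [pow_add]; ring
      have hgood : (4 : ℝ) ^ Nat.log 4 (u i) ≤ 4 * D * 4 ^ Nat.log 4 (v j) ∧
          (4 : ℝ) ^ Nat.log 4 (v j) ≤ 4 * D * 4 ^ Nat.log 4 (u i) ∧
          D ≤ 16 * 4 ^ (Nat.log 4 (u i) + Nat.log 4 (v j)) := by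
        refine ⟨?_, ?_, h3.le.trans huv⟩
        · calc _ ≤ (u i : ℝ) := a1
            _ ≤ D * v j := h1.le
            _ ≤ D * (4 * 4 ^ Nat.log 4 (v j)) := by gcongr
            _ = _ := by ring
        · calc _ ≤ (v j : ℝ) := b1
            _ ≤ D * u i := h2.le
            _ ≤ D * (4 * 4 ^ Nat.log 4 (u i)) := by gcongr
            _ = _ := by ring
      have hGv : G (Nat.log 4 (u i)) (Nat.log 4 (v j)) =
          16 * 4 ^ (Nat.log 4 (u i) + Nat.log 4 (v j)) := if_pos hgood
      rw [hGv, mul_comm]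
      exact mul_le_mul_of_nonneg_right huv (adjMat_nonneg ω i j)
    · rw [mul_zero]
      exact sum_nonneg fun a _ => sum_nonneg fun b _ => hterm a b
  have hsum : ∑ i, ∑ j, ∑ a ∈ range N, ∑ b ∈ range N,
        G a b * (if i ∈ levelSet u a then (if j ∈ levelSet v b then adjMat ω i j else 0) else 0) =
      ∑ a ∈ range N, ∑ b ∈ range N, G a b * eCountC ω (levelSet u a) (levelSet v b) := by
    calc _ = ∑ i, ∑ a ∈ range N, ∑ b ∈ range N, ∑ j,
          G a b * (if i ∈ levelSet u a then (if j ∈ levelSet v b then adjMat ω i j else 0) else 0) := by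
          refine sum_congr rfl fun i _ => ?_
          rw [sum_comm]
          exact sum_congr rfl fun a _ => sum_comm
      _ = ∑ a ∈ range N, ∑ b ∈ range N, ∑ i, ∑ j,
          G a b * (if i ∈ levelSet u a then (if j ∈ levelSet v b then adjMat ω i j else 0) else 0) := by
          rw [sum_comm]
          exact sum_congr rfl fun a _ => sum_comm
      _ = _ := by
          refine sum_congr rfl fun a _ => sum_congr rfl fun b _ => ?_
          simp_rw [← mul_sum]
          rw [eCountC_eq_sum_adjMat]
          congr 1
          calc _ = ∑ i, if i ∈ levelSet u a then ∑ j ∈ levelSet v b, adjMat ω i j else 0 := by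
                refine sum_congr rfl fun i _ => ?_
                split_ifs
                · simp [sum_ite_mem]
                · simp
            _ = _ := by simp [sum_ite_mem]
  have hXs := (sum_card_levelSet_mul_le u N).trans hu
  have hYs := (sum_card_levelSet_mul_le v N).trans hv
  have hX1 : ∀ a ∈ range N, (#(levelSet u a) : ℝ) * 16 ^ a ≤ 16 * n := fun a ha =>
    (single_le_sum (f := fun a => (#(levelSet u a) : ℝ) * 16 ^ a)
      (fun a _ => by positivity) ha).trans hXs
  have hY1 : ∀ a ∈ range N, (#(levelSet v a) : ℝ) * 16 ^ a ≤ 16 * n := fun a ha =>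
    (single_le_sum (f := fun a => (#(levelSet v a) : ℝ) * 16 ^ a)
      (fun a _ => by positivity) ha).trans hYs
  have hlev : ∀ a ∈ range N, ∀ b ∈ range N, G a b * eCountC ω (levelSet u a) (levelSet v b) ≤
      32768 * (levelBound n D (#(levelSet u a) * 16 ^ a) (#(levelSet v b) * 16 ^ b) a b +
        levelBound n D (#(levelSet v b) * 16 ^ b) (#(levelSet u a) * 16 ^ a) b a) := by
    intro a ha b hb
    have n1 := levelBound_nonneg (ξ := #(levelSet u a) * 16 ^ a) (η := #(levelSet v b) * 16 ^ b)
      hn' hD (by positivity) (by positivity) a b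
    have n2 := levelBound_nonneg (ξ := #(levelSet v b) * 16 ^ b) (η := #(levelSet u a) * 16 ^ a)
      hn' hD (by positivity) (by positivity) b a
    simp only [hG]
    split_ifs with h
    · have := eCountC_levelSet_le hn hD hdisc (hX1 a ha) (hY1 b hb) h.1 h.2.1 h.2.2
      linarith
    · linarith
  have s1 := sum_levelBound_le (N := N) hn' hD (ξ := fun a => #(levelSet u a) * 16 ^ a)
    (η := fun a => #(levelSet v a) * 16 ^ a) (fun a => by positivity) hXs hYs
  have s2 := sum_levelBound_le (N := N) hn' hD (ξ := fun a => #(levelSet v a) * 16 ^ a)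
    (η := fun a => #(levelSet u a) * 16 ^ a) (fun a => by positivity) hYs hXs
  rw [sum_comm] at s2
  calc _ ≤ _ := sum_le_sum fun i _ => sum_le_sum fun j _ => hpt i j
    _ = _ := hsum
    _ ≤ _ := sum_le_sum fun a ha => sum_le_sum fun b hb => hlev a ha b hb
    _ ≤ _ := by
      simp_rw [← mul_sum, sum_add_distrib]
      linarith

theorem sum_adjMat_heavy_le {n : ℕ} (hn : 0 < n) {D : ℝ} (hD : 0 < D) {ω : Config n}
    (hdisc : DiscrepancyBound (D ^ 2 / n) ω) {u v : Fin n → ℕ}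
    (hu : ∑ i, (u i : ℝ) ^ 2 ≤ 16 * n) (hv : ∑ i, (v i : ℝ) ^ 2 ≤ 16 * n)
    (hdu : ∀ i, u i ≠ 0 → ∑ j, adjMat ω i j ≤ 20 * D ^ 2)
    (hdv : ∀ i, v i ≠ 0 → ∑ j, adjMat ω i j ≤ 20 * D ^ 2) :
    ∑ i, ∑ j, adjMat ω i j * (if D < u i * v j then (u i : ℝ) * v j else 0) ≤
      27525760 * n * D := by
  have hrow : ∀ w : Fin n → ℕ, ∑ i, (w i : ℝ) ^ 2 ≤ 16 * n →
      (∀ i, w i ≠ 0 → ∑ j, adjMat ω i j ≤ 20 * D ^ 2) →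
      ∑ i, ∑ j, adjMat ω i j * ((w i : ℝ) ^ 2 / D) ≤ 320 * n * D := by
    intro w hw hdw
    calc _ ≤ ∑ i, (w i : ℝ) ^ 2 * (20 * D) := by
          refine sum_le_sum fun i _ => ?_
          rw [← sum_mul]
          by_cases h0 : w i = 0
          · simp [h0]
          · calc _ ≤ 20 * D ^ 2 * ((w i : ℝ) ^ 2 / D) := by gcongr; exact hdw i h0
              _ = _ := by field_simp
      _ = (∑ i, (w i : ℝ) ^ 2) * (20 * D) := by rw [sum_mul]
      _ ≤ 16 * n * (20 * D) := by gcongr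
      _ = _ := by ring
  have h1 := hrow u hu hdu
  have h2 := hrow v hv hdv
  rw [sum_comm] at h2
  have h3 := sum_comparable_le hn hD hdisc hu hv
  have hpt : ∀ i j, adjMat ω i j * (if D < u i * v j then (u i : ℝ) * v j else 0) ≤
      adjMat ω i j * ((u i : ℝ) ^ 2 / D) + adjMat ω j i * ((v j : ℝ) ^ 2 / D) +
      adjMat ω i j * (if (u i : ℝ) < D * v j ∧ (v j : ℝ) < D * u i ∧ D < u i * v j
        then (u i : ℝ) * v j else 0) := by
    intro i j
    rw [adjMat_symm ω j i, ← mul_add, ← mul_add]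
    refine mul_le_mul_of_nonneg_left ?_ (adjMat_nonneg ω i j)
    have p1 : 0 ≤ (u i : ℝ) ^ 2 / D := by positivity
    have p2 : 0 ≤ (v j : ℝ) ^ 2 / D := by positivity
    have p3 : (0 : ℝ) ≤ (u i : ℝ) * v j := by positivity
    by_cases c0 : D < u i * v j
    · by_cases c1 : (u i : ℝ) < D * v j
      · by_cases c2 : (v j : ℝ) < D * u i
        · rw [if_pos c0, if_pos ⟨c1, c2, c0⟩]; linarith
        · have : (u i : ℝ) * v j ≤ (v j : ℝ) ^ 2 / D := by
            rw [le_div_iff₀ hD]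
            nlinarith [Nat.cast_nonneg (α := ℝ) (v j)]
          rw [if_pos c0]
          split_ifs <;> linarith
      · have : (u i : ℝ) * v j ≤ (u i : ℝ) ^ 2 / D := by
          rw [le_div_iff₀ hD]
          nlinarith [Nat.cast_nonneg (α := ℝ) (u i)]
        rw [if_pos c0]
        split_ifs <;> linarith
    · rw [if_neg c0]
      split_ifs <;> linarith
  refine (sum_le_sum fun i _ => sum_le_sum fun j _ => hpt i j).trans ?_
  simp_rw [sum_add_distrib]
  linarith

theorem sum_edges_le {n : ℕ} (f : Fin n → Fin n → ℝ) (hf : ∀ i j, 0 ≤ f i j) :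
    ∑ e : EdgeIdx n, (f e.1.1 e.1.2 + f e.1.2 e.1.1) ≤ ∑ i, ∑ j, f i j := by
  have h := sum_sum_eq_sum_edges (fun i j => if i = j then 0 else f i j) (by simp)
  have h' : ∑ e : EdgeIdx n, ((if e.1.1 = e.1.2 then 0 else f e.1.1 e.1.2) +
      (if e.1.2 = e.1.1 then 0 else f e.1.2 e.1.1)) =
      ∑ e : EdgeIdx n, (f e.1.1 e.1.2 + f e.1.2 e.1.1) :=
    sum_congr rfl fun e _ => by rw [if_neg e.2.ne, if_neg e.2.ne']
  rw [← h', ← h]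
  refine sum_le_sum fun i _ => sum_le_sum fun j _ => ?_
  split_ifs
  exacts [hf i j, le_rfl]

theorem genMeasure_eCountC_eq_le {n : ℕ} {p : Fin n → Fin n → ℝ} (h0 : ∀ i j, 0 ≤ p i j)
    (h1 : ∀ i j, p i j ≤ 1) {s : ℝ} (hs : 0 < s) (hps : ∀ i j, p i j ≤ s)
    {X Y : Finset (Fin n)} (hX : X.Nonempty) (hY : Y.Nonempty) {t K : ℝ}
    (ht : Real.exp 4 * (s * #X * #Y) < t) (htK : 32 * K < t * Real.log (t / (s * #X * #Y))) :
    (genMeasure p).real {ω | eCountC ω X Y = t} ≤ Real.exp (-(8 * K)) := by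
  have hX0 : (0 : ℝ) < #X := by exact_mod_cast hX.card_pos
  have hY0 : (0 : ℝ) < #Y := by exact_mod_cast hY.card_pos
  set μ := s * #X * #Y with hμ
  have hμ0 : 0 < μ := by positivity
  have ht0 : 0 < t := lt_trans (by positivity) ht
  set r := t / μ with hr
  have hr4 : Real.exp 4 < r := by rw [hr, lt_div_iff₀ hμ0]; exact ht
  have hr0 : 0 < r := (Real.exp_pos _).trans hr4
  have hlr : 4 < Real.log r := by rwa [Real.lt_log_iff_exp_lt hr0]
  set f : Fin n → Fin n → ℝ := fun i j => if i ∈ X ∧ j ∈ Y then 1 else 0 with hf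
  have hf01 : ∀ i j, f i j = 0 ∨ f i j = 1 := fun i j => by
    simp only [hf]; split_ifs <;> simp
  have hf0 : ∀ i j, 0 ≤ f i j := fun i j => by rcases hf01 i j with h | h <;> simp [h]
  have hcount : ∀ ω : Config n, eCountC ω X Y =
      ∑ e : EdgeIdx n, (f e.1.1 e.1.2 + f e.1.2 e.1.1) * (if ω e then 1 else 0) := by
    intro ω
    rw [← sum_sum_adjMat_mul, eCountC_eq_sum_adjMat]
    calc _ = ∑ i, if i ∈ X then ∑ j ∈ Y, adjMat ω i j else 0 := by simp [sum_ite_mem]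
      _ = _ := by
        refine sum_congr rfl fun i _ => ?_
        split_ifs with hi
        · simp [hf, hi, sum_ite_mem]
        · simp [hf, hi]
  set θ := Real.log r / 2 with hθ
  have hθ0 : 0 < θ := by linarith
  have hθ2 : Real.exp (2 * θ) = r := by
    rw [hθ, mul_div_cancel₀ _ (two_ne_zero' ℝ), Real.exp_log hr0]
  have hb := genMeasure_real_le_exp h0 h1
    (fun e : EdgeIdx n => θ * (f e.1.1 e.1.2 + f e.1.2 e.1.1)) (θ * t)
  have hsub : {ω : Config n | eCountC ω X Y = t} ⊆ {ω | θ * t ≤ ∑ e : EdgeIdx n,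
      θ * (f e.1.1 e.1.2 + f e.1.2 e.1.1) * (if ω e then 1 else 0)} := by
    intro ω hω
    simp only [Set.mem_ofPred_eq] at hω ⊢
    simp_rw [mul_assoc]
    rw [← mul_sum, ← hcount, hω]
  refine (measureReal_mono hsub).trans (hb.trans (Real.exp_le_exp.2 ?_))
  have hterm : ∀ e : EdgeIdx n, p e.1.1 e.1.2 *
      (Real.exp (θ * (f e.1.1 e.1.2 + f e.1.2 e.1.1)) - 1) ≤
      s * r * (f e.1.1 e.1.2 + f e.1.2 e.1.1) := by
    intro e
    have h2 : Real.exp (θ * (f e.1.1 e.1.2 + f e.1.2 e.1.1)) - 1 ≤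
        r * (f e.1.1 e.1.2 + f e.1.2 e.1.1) := by
      have hr1 : Real.exp θ ≤ r := by
        rw [← hθ2]; exact Real.exp_le_exp.2 (by linarith)
      rcases hf01 e.1.1 e.1.2 with h | h <;> rcases hf01 e.1.2 e.1.1 with h' | h' <;>
        simp only [h, h', add_zero, zero_add, mul_zero, mul_one, Real.exp_zero, sub_self, le_refl]
      · linarith
      · linarith
      · rw [one_add_one_eq_two, mul_comm θ, hθ2]; linarith
    have h3 : 0 ≤ r * (f e.1.1 e.1.2 + f e.1.2 e.1.1) :=
      mul_nonneg hr0.le (add_nonneg (hf0 _ _) (hf0 _ _))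
    calc _ ≤ p e.1.1 e.1.2 * (r * (f e.1.1 e.1.2 + f e.1.2 e.1.1)) :=
          mul_le_mul_of_nonneg_left h2 (h0 _ _)
      _ ≤ s * (r * (f e.1.1 e.1.2 + f e.1.2 e.1.1)) := mul_le_mul_of_nonneg_right (hps _ _) h3
      _ = _ := by ring
  have hfs : ∑ i, ∑ j, f i j = #X * #Y := by
    calc _ = ∑ i, if i ∈ X then (#Y : ℝ) else 0 := by
          refine sum_congr rfl fun i _ => ?_
          by_cases hi : i ∈ X <;> simp [hf, hi]
      _ = _ := by simp
  have hsum : ∑ e : EdgeIdx n, p e.1.1 e.1.2 *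
      (Real.exp (θ * (f e.1.1 e.1.2 + f e.1.2 e.1.1)) - 1) ≤ t := by
    refine (sum_le_sum fun e _ => hterm e).trans ?_
    rw [← mul_sum]
    calc _ ≤ s * r * ∑ i, ∑ j, f i j := by gcongr; exact sum_edges_le f hf0
      _ = r * μ := by rw [hfs, hμ]; ring
      _ = t := by rw [hr]; field_simp
  have : t * 4 ≤ t * Real.log r := by gcongr
  have : θ * t = t * Real.log r / 2 := by rw [hθ]; ring
  linarith

/-- An upper bound for the logarithm of the number of subsets of size at most `k`. -/
noncomputable def subsetEntropy (n k : ℕ) : ℝ := k * Real.log (Real.exp 1 * n / k)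

theorem card_filter_card_le {n k : ℕ} (hk : 0 < k) (hkn : k ≤ n) :
    (#(univ.filter fun X : Finset (Fin n) => #X ≤ k) : ℝ) ≤ Real.exp (subsetEntropy n k) := by
  have hn : 0 < n := hk.trans_le hkn
  have hn' : (0 : ℝ) < n := by exact_mod_cast hn
  have hk' : (0 : ℝ) < k := by exact_mod_cast hk
  set q : ℝ := k / n with hq
  have hq0 : 0 < q := by positivity
  have hq1 : q ≤ 1 := by rw [hq, div_le_one hn']; exact_mod_cast hkn
  have h1 : (#(univ.filter fun X : Finset (Fin n) => #X ≤ k) : ℝ) * q ^ k ≤ (1 + q) ^ n := by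
    calc _ ≤ ∑ X ∈ univ.filter (fun X : Finset (Fin n) => #X ≤ k), q ^ #X := by
          rw [← nsmul_eq_mul]
          refine card_nsmul_le_sum _ _ _ fun X hX => ?_
          exact pow_le_pow_of_le_one hq0.le hq1 (by simpa using hX)
      _ ≤ ∑ X : Finset (Fin n), q ^ #X :=
          sum_le_sum_of_subset_of_nonneg (filter_subset _ _) fun _ _ _ => by positivity
      _ = (1 + q) ^ n := by
          have := Fin.sum_pow_mul_eq_add_pow (n := n) q 1
          simpa [add_comm] using this
  have h2 : (1 + q) ^ n ≤ Real.exp k := by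
    calc (1 + q) ^ n ≤ (Real.exp q) ^ n := by
          gcongr
          linarith [Real.add_one_le_exp q]
      _ = Real.exp k := by
          rw [← Real.exp_nat_mul, hq]; congr 1; field_simp
  have h3 : Real.exp (subsetEntropy n k) * q ^ k = Real.exp k := by
    unfold subsetEntropy
    rw [Real.exp_nat_mul, Real.exp_log (by positivity), ← mul_pow, hq]
    rw [show Real.exp 1 * n / k * (k / n) = Real.exp 1 by field_simp, ← Real.exp_nat_mul, mul_one]
  refine le_of_mul_le_mul_right ?_ (show 0 < q ^ k by positivity)
  rw [h3]
  exact h1.trans h2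

theorem log_le_subsetEntropy {n k : ℕ} (hk : 0 < k) (hkn : k ≤ n) :
    Real.log n ≤ subsetEntropy n k := by
  have h : (n : ℝ) ≤ Real.exp (subsetEntropy n k) := by
    refine le_trans ?_ (card_filter_card_le hk hkn)
    have : #(univ.image fun i : Fin n => ({i} : Finset (Fin n))) = n := by
      rw [card_image_of_injective _ (fun a b h => by simpa using h)]; simp
    conv_lhs => rw [← this]
    norm_cast
    refine card_le_card fun X hX => ?_
    obtain ⟨i, -, rfl⟩ := mem_image.1 hX
    simp; omega
  have hn : (0 : ℝ) < n := by exact_mod_cast hk.trans_le hkn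
  exact (Real.log_le_iff_le_exp hn).2 h

theorem eCountC_eq_card {n : ℕ} (ω : Config n) (X Y : Finset (Fin n)) :
    ∃ t ∈ range (n ^ 2 + 1), eCountC ω X Y = (t : ℕ) := by
  refine ⟨∑ i ∈ X, ∑ j ∈ Y, if adjOf ω i j then 1 else 0, ?_, by simp [eCountC]⟩
  rw [mem_range, Nat.lt_succ_iff]
  calc _ ≤ ∑ i ∈ X, ∑ j ∈ Y, 1 := by
        refine sum_le_sum fun i _ => sum_le_sum fun j _ => ?_
        split_ifs <;> norm_num
    _ = #X * #Y := by simp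
    _ ≤ n * n := by gcongr <;> exact (card_le_univ _).trans_eq (Fintype.card_fin n)
    _ = _ := by ring

theorem genMeasure_not_discrepancyBound_le {n : ℕ} (hn : 0 < n) {p : Fin n → Fin n → ℝ}
    (h0 : ∀ i j, 0 ≤ p i j) (h1 : ∀ i j, p i j ≤ 1) {s : ℝ} (hs : 0 < s)
    (hps : ∀ i j, p i j ≤ s) :
    (genMeasure p).real {ω | ¬ DiscrepancyBound s ω} ≤ 2 / n := by
  have hn' : (0 : ℝ) < n := by exact_mod_cast hn
  have hcn : ∀ Y : Finset (Fin n), #Y ≤ n := fun Y => (card_le_univ Y).trans_eq (Fintype.card_fin n)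
  set B : Finset (Fin n) → Finset (Fin n) → Set (Config n) := fun X Y =>
    {ω | Real.exp 4 * (s * #X * #Y) < eCountC ω X Y ∧ 32 * subsetEntropy n #Y <
      eCountC ω X Y * Real.log (eCountC ω X Y / (s * #X * #Y))} with hB
  have hBle : ∀ X Y : Finset (Fin n), X.Nonempty → Y.Nonempty →
      (genMeasure p).real (B X Y) ≤ ((n : ℝ) ^ 2 + 1) * Real.exp (-(8 * subsetEntropy n #Y)) := by
    intro X Y hX hY
    set T := (range (n ^ 2 + 1)).filter fun t : ℕ => Real.exp 4 * (s * #X * #Y) < t ∧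
      32 * subsetEntropy n #Y < t * Real.log (t / (s * #X * #Y)) with hT
    have hsub : B X Y ⊆ ⋃ t ∈ T, {ω | eCountC ω X Y = (t : ℕ)} := by
      intro ω hω
      obtain ⟨t, ht, hte⟩ := eCountC_eq_card ω X Y
      simp only [hB, Set.mem_ofPred_eq, hte] at hω
      simp only [Set.mem_iUnion, Set.mem_ofPred_eq]
      exact ⟨t, mem_filter.2 ⟨ht, hω⟩, hte⟩
    calc _ ≤ _ := measureReal_mono hsub (measure_ne_top _ _)
      _ ≤ ∑ t ∈ T, (genMeasure p).real {ω | eCountC ω X Y = (t : ℕ)} :=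
          measureReal_biUnion_finset_le _ _
      _ ≤ ∑ t ∈ T, Real.exp (-(8 * subsetEntropy n #Y)) := sum_le_sum fun t ht =>
          genMeasure_eCountC_eq_le h0 h1 hs hps hX hY (mem_filter.1 ht).2.1 (mem_filter.1 ht).2.2
      _ ≤ ∑ t ∈ range (n ^ 2 + 1), Real.exp (-(8 * subsetEntropy n #Y)) :=
          sum_le_sum_of_subset_of_nonneg (filter_subset _ _) fun _ _ _ => (Real.exp_pos _).le
      _ = _ := by simp
  have hsub : {ω | ¬ DiscrepancyBound s ω} ⊆
      ⋃ Y ∈ univ.filter (fun Y : Finset (Fin n) => Y.Nonempty),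
        ⋃ X ∈ univ.filter (fun X : Finset (Fin n) => X.Nonempty ∧ #X ≤ #Y), B X Y := by
    intro ω hω
    simp only [Set.mem_ofPred_eq, DiscrepancyBound] at hω
    push Not at hω
    obtain ⟨X, Y, hX, hXY, hb⟩ := hω
    simp only [Set.mem_iUnion]
    exact ⟨Y, by simpa using card_pos.1 (hX.card_pos.trans_le hXY), X, by simp [hX, hXY], hb⟩
  have hY : ∀ Y ∈ univ.filter (fun Y : Finset (Fin n) => Y.Nonempty), (genMeasure p).real
      (⋃ X ∈ univ.filter (fun X : Finset (Fin n) => X.Nonempty ∧ #X ≤ #Y), B X Y) ≤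
      ((n : ℝ) ^ 2 + 1) * Real.exp (-(7 * subsetEntropy n #Y)) := by
    intro Y hY
    have hY : Y.Nonempty := by simpa using hY
    calc _ ≤ _ := measureReal_biUnion_finset_le _ _
      _ ≤ ∑ X ∈ univ.filter (fun X : Finset (Fin n) => X.Nonempty ∧ #X ≤ #Y),
          ((n : ℝ) ^ 2 + 1) * Real.exp (-(8 * subsetEntropy n #Y)) := by
          refine sum_le_sum fun X hX => hBle X Y (by simp at hX; exact hX.1) hY
      _ ≤ ∑ X ∈ univ.filter (fun X : Finset (Fin n) => #X ≤ #Y),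
          ((n : ℝ) ^ 2 + 1) * Real.exp (-(8 * subsetEntropy n #Y)) := by
          refine sum_le_sum_of_subset_of_nonneg (fun X hX => ?_) fun _ _ _ => by positivity
          simp at hX ⊢; exact hX.2
      _ ≤ Real.exp (subsetEntropy n #Y) *
          (((n : ℝ) ^ 2 + 1) * Real.exp (-(8 * subsetEntropy n #Y))) := by
          rw [sum_const, nsmul_eq_mul]
          gcongr
          exact card_filter_card_le hY.card_pos (hcn Y)
      _ = ((n : ℝ) ^ 2 + 1) * (Real.exp (subsetEntropy n #Y) *
          Real.exp (-(8 * subsetEntropy n #Y))) := by ring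
      _ = _ := by rw [← Real.exp_add]; congr 2; ring
  have hk : ∀ k ∈ Icc 1 n, ∑ Y ∈ (univ.filter (fun Y : Finset (Fin n) => Y.Nonempty)).filter
      (fun Y => #Y = k), ((n : ℝ) ^ 2 + 1) * Real.exp (-(7 * subsetEntropy n #Y)) ≤
      ((n : ℝ) ^ 2 + 1) * (1 / (n : ℝ) ^ 6) := by
    intro k hk
    obtain ⟨hk1, hk2⟩ := mem_Icc.1 hk
    calc _ = ∑ Y ∈ (univ.filter (fun Y : Finset (Fin n) => Y.Nonempty)).filter
          (fun Y => #Y = k), ((n : ℝ) ^ 2 + 1) * Real.exp (-(7 * subsetEntropy n k)) := by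
          refine sum_congr rfl fun Y hY => ?_
          rw [(mem_filter.1 hY).2]
      _ ≤ Real.exp (subsetEntropy n k) *
          (((n : ℝ) ^ 2 + 1) * Real.exp (-(7 * subsetEntropy n k))) := by
          rw [sum_const, nsmul_eq_mul]
          gcongr
          refine le_trans ?_ (card_filter_card_le hk1 hk2)
          norm_cast
          refine card_le_card fun Y hY => ?_
          simp at hY ⊢; exact hY.2.le
      _ = ((n : ℝ) ^ 2 + 1) * (Real.exp (subsetEntropy n k) *
          Real.exp (-(7 * subsetEntropy n k))) := by ring
      _ ≤ _ := by
          rw [← Real.exp_add]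
          gcongr
          calc _ ≤ Real.exp ((6 : ℕ) * (-Real.log n)) := by
                refine Real.exp_le_exp.2 ?_
                have := log_le_subsetEntropy hk1 hk2
                push_cast; linarith
            _ = _ := by rw [Real.exp_nat_mul, Real.exp_neg, Real.exp_log hn']; simp
  calc _ ≤ _ := measureReal_mono hsub (measure_ne_top _ _)
    _ ≤ _ := measureReal_biUnion_finset_le _ _
    _ ≤ _ := sum_le_sum hY
    _ = _ := (sum_fiberwise_of_maps_to (t := Icc 1 n) (g := fun Y : Finset (Fin n) => #Y)
          (fun Y hY => mem_Icc.2 ⟨by simpa [Nat.one_le_iff_ne_zero, Finset.nonempty_iff_ne_empty]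
            using hY, hcn Y⟩) _).symm
    _ ≤ _ := sum_le_sum hk
    _ ≤ 2 / n := by
      rw [sum_const, Nat.card_Icc, nsmul_eq_mul]
      simp only [add_tsub_cancel_right]
      rw [← sub_nonneg]
      have h1n : (1 : ℝ) ≤ n := by exact_mod_cast hn
      have : (2 : ℝ) / n - n * (((n : ℝ) ^ 2 + 1) * (1 / (n : ℝ) ^ 6)) =
          ((n : ℝ) ^ 2 * (n ^ 2 - 1) + (n ^ 4 - 1 * 1)) / n ^ 5 := by
        field_simp; ring
      have h2 : (1 : ℝ) ≤ n ^ 2 := one_le_pow₀ h1n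
      have h4 : (1 : ℝ) ≤ n ^ 4 := one_le_pow₀ h1n
      rw [this]
      have : (0 : ℝ) ≤ n ^ 2 * (n ^ 2 - 1) := mul_nonneg (by positivity) (by linarith)
      exact div_nonneg (by linarith) (by positivity)

theorem centeredMat_eq {n : ℕ} {p : Fin n → Fin n → ℝ} (ω : Config n) {i j : Fin n} (h : i ≠ j) :
    centeredMat p ω i j = adjMat ω i j - p i j := by
  simp [centeredMat, adjMat, h]

theorem sum_sum_centeredMat_mul {n : ℕ} {p : Fin n → Fin n → ℝ} (hp : ∀ i j, p i j = p j i)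
    (ω : Config n) (f : Fin n → Fin n → ℝ) :
    ∑ i, ∑ j, centeredMat p ω i j * f i j =
      ∑ e : EdgeIdx n, (f e.1.1 e.1.2 + f e.1.2 e.1.1) *
        ((if ω e then 1 else 0) - p e.1.1 e.1.2) := by
  rw [sum_sum_eq_sum_edges (fun i j => centeredMat p ω i j * f i j) (by simp [centeredMat])]
  refine sum_congr rfl fun e _ => ?_
  rw [centeredMat_eq ω e.2.ne, centeredMat_eq ω e.2.ne', adjMat_symm ω e.1.2, adjMat_edge,
    hp e.1.2]
  ring

theorem genMeasure_centeredMat_sum_le {n : ℕ} (hn : 0 < n) {p : Fin n → Fin n → ℝ}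
    (h0 : ∀ i j, 0 ≤ p i j) (h1 : ∀ i j, p i j ≤ 1) (hp : ∀ i j, p i j = p j i) {D : ℝ}
    (hD : 0 < D) (hpD : ∀ i j, p i j ≤ D ^ 2 / n) {f : Fin n → Fin n → ℝ}
    (hf : ∀ i j, |f i j| ≤ D) (hf2 : ∑ i, ∑ j, f i j ^ 2 ≤ 256 * n ^ 2) :
    (genMeasure p).real {ω | 400 * n * D ≤ ∑ i, ∑ j, centeredMat p ω i j * f i j} ≤
      Real.exp (-(72 * n)) := by
  have hn' : (0 : ℝ) < n := by exact_mod_cast hn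
  set c : EdgeIdx n → ℝ := fun e => (f e.1.1 e.1.2 + f e.1.2 e.1.1) / (2 * D) with hc
  have hc1 : ∀ e, |c e| ≤ 1 := fun e => by
    rw [hc, abs_div, abs_of_pos (show 0 < 2 * D by positivity), div_le_one (by positivity)]
    exact (abs_add_le _ _).trans (by linarith [hf e.1.1 e.1.2, hf e.1.2 e.1.1])
  have hb := genMeasure_real_le_exp h0 h1 c (200 * n + ∑ e, c e * p e.1.1 e.1.2)
  have hsub : {ω | 400 * n * D ≤ ∑ i, ∑ j, centeredMat p ω i j * f i j} ⊆
      {ω : Config n | 200 * n + ∑ e, c e * p e.1.1 e.1.2 ≤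
        ∑ e, c e * (if ω e then 1 else 0)} := by
    intro ω hω
    simp only [Set.mem_ofPred_eq] at hω ⊢
    rw [sum_sum_centeredMat_mul hp] at hω
    have : ∑ e : EdgeIdx n, (f e.1.1 e.1.2 + f e.1.2 e.1.1) *
        ((if ω e then 1 else 0) - p e.1.1 e.1.2) =
        2 * D * (∑ e, c e * (if ω e then 1 else 0) - ∑ e, c e * p e.1.1 e.1.2) := by
      rw [← sum_sub_distrib, mul_sum]
      refine sum_congr rfl fun e _ => ?_
      simp only [hc]
      field_simp
    rw [this] at hω
    nlinarith
  refine (measureReal_mono hsub (measure_ne_top _ _)).trans (hb.trans (Real.exp_le_exp.2 ?_))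
  have hterm : ∀ e : EdgeIdx n, p e.1.1 e.1.2 * (Real.exp (c e) - 1) ≤ c e * p e.1.1 e.1.2 +
      (1 / (2 * n)) * (f e.1.1 e.1.2 ^ 2 + f e.1.2 e.1.1 ^ 2) := by
    intro e
    have h2 : Real.exp (c e) - 1 - c e ≤ c e ^ 2 :=
      (le_abs_self _).trans (Real.abs_exp_sub_one_sub_id_le (hc1 e))
    have h3 : p e.1.1 e.1.2 * c e ^ 2 ≤
        (1 / (2 * n)) * (f e.1.1 e.1.2 ^ 2 + f e.1.2 e.1.1 ^ 2) := by
      calc _ ≤ D ^ 2 / n * c e ^ 2 := by gcongr; exact hpD _ _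
        _ = (1 / (4 * n)) * (f e.1.1 e.1.2 + f e.1.2 e.1.1) ^ 2 := by
            simp only [hc]; field_simp; norm_num
        _ ≤ (1 / (4 * n)) * (2 * (f e.1.1 e.1.2 ^ 2 + f e.1.2 e.1.1 ^ 2)) := by
            gcongr; exact add_sq_le
        _ = _ := by field_simp; norm_num
    have := mul_le_mul_of_nonneg_left h2 (h0 e.1.1 e.1.2)
    linarith
  have h4 := sum_le_sum fun e (_ : e ∈ univ) => hterm e
  rw [sum_add_distrib, ← mul_sum] at h4
  have h5 : (1 / (2 * (n : ℝ))) * ∑ e : EdgeIdx n, (f e.1.1 e.1.2 ^ 2 + f e.1.2 e.1.1 ^ 2) ≤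
      128 * n := by
    calc _ ≤ (1 / (2 * (n : ℝ))) * (256 * n ^ 2) := by
          gcongr
          exact (sum_edges_le (fun i j => f i j ^ 2) fun _ _ => sq_nonneg _).trans hf2
      _ = _ := by field_simp; norm_num
  linarith

/-- The integer points of the Euclidean ball of radius `4 * √n`. -/
noncomputable def integerNet (n : ℕ) : Finset (Fin n → ℤ) :=
  (Fintype.piFinset fun _ => Icc (-(16 * n : ℤ)) (16 * n)).filter fun m => ∑ i, m i ^ 2 ≤ 16 * n

theorem mem_integerNet {n : ℕ} {m : Fin n → ℤ} : m ∈ integerNet n ↔ ∑ i, m i ^ 2 ≤ 16 * n := by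
  refine ⟨fun h => (mem_filter.1 h).2, fun h => mem_filter.2 ⟨?_, h⟩⟩
  rw [Fintype.mem_piFinset]
  intro i
  have h1 : m i ^ 2 ≤ ∑ i, m i ^ 2 :=
    single_le_sum (f := fun i => m i ^ 2) (fun _ _ => sq_nonneg _) (mem_univ i)
  have h2 : |m i| ≤ m i ^ 2 := by
    rw [← sq_abs]
    exact Int.le_self_sq _
  exact mem_Icc.2 (abs_le.1 (h2.trans (h1.trans h)))

theorem sum_Icc_half_pow_natAbs (R : ℕ) :
    ∑ k ∈ Icc (-(R : ℤ)) R, (1 / 2 : ℝ) ^ k.natAbs = 3 - 2 * (1 / 2) ^ R := by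
  induction R with
  | zero => norm_num
  | succ R ih =>
    have h : Icc (-((R + 1 : ℕ) : ℤ)) ((R + 1 : ℕ) : ℤ) =
        insert (-((R + 1 : ℕ) : ℤ)) (insert ((R + 1 : ℕ) : ℤ) (Icc (-(R : ℤ)) R)) := by
      ext k; simp only [mem_insert, mem_Icc]; omega
    rw [h, sum_insert, sum_insert, ih]
    · simp only [Int.natAbs_neg, Int.natAbs_natCast, pow_succ]; ring
    · simp
    · simp only [mem_insert, mem_Icc]; omega

theorem card_integerNet_le (n : ℕ) : (#(integerNet n) : ℝ) ≤ 196608 ^ n := by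
  have h1 : (#(integerNet n) : ℝ) * (1 / 2) ^ (16 * n) ≤ 3 ^ n := by
    calc _ ≤ ∑ m ∈ integerNet n, ∏ i, (1 / 2 : ℝ) ^ (m i).natAbs := by
          rw [← nsmul_eq_mul]
          refine card_nsmul_le_sum _ _ _ fun m hm => ?_
          rw [prod_pow_eq_pow_sum]
          refine pow_le_pow_of_le_one (by norm_num) (by norm_num) ?_
          have h := mem_integerNet.1 hm
          zify
          refine le_trans (sum_le_sum fun i _ => ?_) h
          rw [← sq_abs]
          exact Int.le_self_sq _
      _ ≤ ∑ m ∈ Fintype.piFinset fun _ : Fin n => Icc (-(16 * n : ℤ)) (16 * n),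
            ∏ i, (1 / 2 : ℝ) ^ (m i).natAbs :=
          sum_le_sum_of_subset_of_nonneg (filter_subset _ _) fun _ _ _ => by positivity
      _ = ∏ _i : Fin n, ∑ k ∈ Icc (-(16 * n : ℤ)) (16 * n), (1 / 2 : ℝ) ^ k.natAbs :=
          (prod_univ_sum (fun _ => Icc (-(16 * n : ℤ)) (16 * n))
            fun _ k => (1 / 2 : ℝ) ^ k.natAbs).symm
      _ ≤ ∏ _i : Fin n, 3 := by
          refine prod_le_prod (fun _ _ => sum_nonneg fun _ _ => by positivity) fun _ _ => ?_
          have h := sum_Icc_half_pow_natAbs (16 * n)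
          push_cast at h
          rw [h, sub_le_self_iff]
          positivity
      _ = 3 ^ n := by simp
  have h2 : (196608 : ℝ) ^ n * (1 / 2) ^ (16 * n) = 3 ^ n := by
    rw [pow_mul, ← mul_pow]; norm_num
  rw [← h2] at h1
  exact le_of_mul_le_mul_right h1 (by positivity)

/-- The truncation of the rank-one matrix `a bᵀ` to its entries of absolute value at most `D`. -/
noncomputable def lightPart {n : ℕ} (D : ℝ) (a b : Fin n → ℤ) (i j : Fin n) : ℝ :=
  if |(a i : ℝ) * b j| ≤ D then (a i : ℝ) * b j else 0

theorem sum_sq_le_of_mem_integerNet {n : ℕ} {m : Fin n → ℤ} (hm : m ∈ integerNet n) :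
    ∑ i, (m i : ℝ) ^ 2 ≤ 16 * n := by
  exact_mod_cast mem_integerNet.1 hm

theorem sum_sum_mul_sq_le {n : ℕ} {a b : Fin n → ℤ} (ha : a ∈ integerNet n)
    (hb : b ∈ integerNet n) : ∑ i, ∑ j, ((a i : ℝ) * b j) ^ 2 ≤ 256 * n ^ 2 := by
  calc _ = (∑ i, (a i : ℝ) ^ 2) * ∑ j, (b j : ℝ) ^ 2 := by
        rw [sum_mul_sum]
        simp_rw [mul_pow]
    _ ≤ (16 * n) * (16 * n) := by
        gcongr <;> exact sum_sq_le_of_mem_integerNet ‹_›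
    _ = _ := by ring

/-- The sums of `centeredMat p ω` against all light parts are small. -/
def LightBound {n : ℕ} (p : Fin n → Fin n → ℝ) (D : ℝ) (ω : Config n) : Prop :=
  ∀ a ∈ integerNet n, ∀ b ∈ integerNet n,
    ∑ i, ∑ j, centeredMat p ω i j * lightPart D a b i j < 400 * n * D

theorem genMeasure_not_lightBound_le {n : ℕ} (hn : 0 < n) {p : Fin n → Fin n → ℝ}
    (h0 : ∀ i j, 0 ≤ p i j) (h1 : ∀ i j, p i j ≤ 1) (hp : ∀ i j, p i j = p j i) {D : ℝ}
    (hD : 0 < D) (hpD : ∀ i j, p i j ≤ D ^ 2 / n) :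
    (genMeasure p).real {ω | ¬ LightBound p D ω} ≤ Real.exp (-n) := by
  have hsub : {ω | ¬ LightBound p D ω} ⊆ ⋃ x ∈ integerNet n ×ˢ integerNet n,
      {ω | 400 * n * D ≤ ∑ i, ∑ j, centeredMat p ω i j * lightPart D x.1 x.2 i j} := by
    intro ω hω
    simp only [Set.mem_ofPred_eq, LightBound] at hω
    push Not at hω
    obtain ⟨a, ha, b, hb, h⟩ := hω
    simp only [Set.mem_iUnion]
    exact ⟨(a, b), mem_product.2 ⟨ha, hb⟩, h⟩
  have hx : ∀ x ∈ integerNet n ×ˢ integerNet n, (genMeasure p).real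
      {ω | 400 * n * D ≤ ∑ i, ∑ j, centeredMat p ω i j * lightPart D x.1 x.2 i j} ≤
      Real.exp (-(72 * n)) := by
    intro x hx
    obtain ⟨ha, hb⟩ := mem_product.1 hx
    refine genMeasure_centeredMat_sum_le hn h0 h1 hp hD hpD (fun i j => ?_)
      (le_trans (sum_le_sum fun i _ => sum_le_sum fun j _ => ?_) (sum_sum_mul_sq_le ha hb))
    · unfold lightPart
      split_ifs with h
      · exact h
      · simpa using hD.le
    · unfold lightPart
      split_ifs
      · exact le_rfl
      · simp only [ne_eq, OfNat.ofNat_ne_zero, not_false_eq_true, zero_pow]; positivity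
  calc _ ≤ _ := measureReal_mono hsub (measure_ne_top _ _)
    _ ≤ _ := measureReal_biUnion_finset_le _ _
    _ ≤ _ := sum_le_sum hx
    _ = (#(integerNet n) : ℝ) ^ 2 * Real.exp (-(72 * n)) := by
      rw [sum_const, card_product, nsmul_eq_mul]; push_cast; ring
    _ ≤ (196608 ^ n) ^ 2 * Real.exp (-(72 * n)) := by gcongr; exact card_integerNet_le n
    _ ≤ (Real.exp 71) ^ n * Real.exp (-(72 * n)) := by
      gcongr
      rw [pow_right_comm]
      gcongr
      calc (196608 : ℝ) ^ 2 ≤ 2 ^ 71 := by norm_num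
        _ ≤ (Real.exp 1) ^ 71 := by gcongr; linarith [Real.add_one_le_exp (1 : ℝ)]
        _ = Real.exp 71 := by rw [← Real.exp_nat_mul]; norm_num
    _ = _ := by rw [← Real.exp_nat_mul, ← Real.exp_add]; congr 1; ring

theorem sum_centeredMat_mul_le {n : ℕ} (hn : 0 < n) {p : Fin n → Fin n → ℝ}
    (h0 : ∀ i j, 0 ≤ p i j) {D : ℝ} (hD : 0 < D) (hpD : ∀ i j, p i j ≤ D ^ 2 / n) {ω : Config n}
    (hdisc : DiscrepancyBound (D ^ 2 / n) ω) (hlight : LightBound p D ω) {a b : Fin n → ℤ}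
    (ha : a ∈ integerNet n) (hb : b ∈ integerNet n)
    (hda : ∀ i, a i ≠ 0 → ∑ j, adjMat ω i j ≤ 20 * D ^ 2)
    (hdb : ∀ i, b i ≠ 0 → ∑ j, adjMat ω i j ≤ 20 * D ^ 2) :
    ∑ i, ∑ j, centeredMat p ω i j * (a i * b j) ≤ 27526416 * n * D := by
  have hn' : (0 : ℝ) < n := by exact_mod_cast hn
  set u : Fin n → ℕ := fun i => (a i).natAbs with hu
  set v : Fin n → ℕ := fun i => (b i).natAbs with hv
  have hua : ∀ i, (u i : ℝ) = |(a i : ℝ)| := fun i => by simp [hu]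
  have hvb : ∀ i, (v i : ℝ) = |(b i : ℝ)| := fun i => by simp [hv]
  have hheavy := sum_adjMat_heavy_le hn hD hdisc (u := u) (v := v)
    (by simp_rw [hua, sq_abs]; exact sum_sq_le_of_mem_integerNet ha)
    (by simp_rw [hvb, sq_abs]; exact sum_sq_le_of_mem_integerNet hb)
    (fun i hi => hda i (by simpa [hu] using hi)) (fun i hi => hdb i (by simpa [hv] using hi))
  have hterm : ∀ i j, centeredMat p ω i j * (a i * b j) ≤
      centeredMat p ω i j * lightPart D a b i j +
      adjMat ω i j * (if D < u i * v j then (u i : ℝ) * v j else 0) +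
      D / n * ((a i : ℝ) * b j) ^ 2 := by
    intro i j
    have huv : (u i : ℝ) * v j = |(a i : ℝ) * b j| := by rw [hua, hvb, abs_mul]
    rw [huv]
    unfold lightPart
    by_cases h : |(a i : ℝ) * b j| ≤ D
    · rw [if_pos h, if_neg h.not_gt, mul_zero, add_zero, le_add_iff_nonneg_right]
      positivity
    rw [if_neg h, mul_zero, zero_add, if_pos (not_le.1 h)]
    have hA := adjMat_nonneg ω i j
    rcases eq_or_ne i j with rfl | hij
    · rw [show centeredMat p ω i i = 0 by simp [centeredMat], zero_mul]
      positivity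
    rw [centeredMat_eq ω hij, sub_mul, sub_eq_add_neg]
    refine add_le_add (mul_le_mul_of_nonneg_left (le_abs_self _) hA) ?_
    calc _ ≤ |p i j * (a i * b j)| := neg_le_abs _
      _ = p i j * |(a i : ℝ) * b j| := by rw [abs_mul, abs_of_nonneg (h0 i j)]
      _ ≤ D ^ 2 / n * |(a i : ℝ) * b j| := by gcongr; exact hpD i j
      _ = D / n * (D * |(a i : ℝ) * b j|) := by ring
      _ ≤ D / n * (|(a i : ℝ) * b j| * |(a i : ℝ) * b j|) := by
          gcongr; exact (not_le.1 h).le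
      _ = _ := by rw [← sq, sq_abs]
  have h1 := sum_le_sum fun i (_ : i ∈ univ) => sum_le_sum fun j (_ : j ∈ univ) => hterm i j
  simp only [sum_add_distrib, ← mul_sum] at h1
  have h2 : D / n * ∑ i, ∑ j, ((a i : ℝ) * b j) ^ 2 ≤ 256 * n * D := by
    calc _ ≤ D / n * (256 * n ^ 2) := by gcongr; exact sum_sum_mul_sq_le ha hb
      _ = _ := by field_simp
  linarith [hlight a ha b hb]

theorem exists_int_sq_le_and_sub_sq_le_one (x : ℝ) :
    ∃ m : ℤ, (m : ℝ) ^ 2 ≤ x ^ 2 ∧ (x - m) ^ 2 ≤ 1 := by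
  rcases le_total 0 x with hx | hx
  · have h1 := Int.floor_le x
    have h2 := Int.lt_floor_add_one x
    have h3 : (0 : ℝ) ≤ ⌊x⌋ := by exact_mod_cast Int.floor_nonneg.2 hx
    exact ⟨⌊x⌋, by gcongr, by nlinarith⟩
  · have h1 := Int.le_ceil x
    have h2 := Int.ceil_lt_add_one x
    have h3 : (⌈x⌉ : ℝ) ≤ 0 := by exact_mod_cast Int.ceil_le.2 (by simpa using hx)
    exact ⟨⌈x⌉, by nlinarith, by nlinarith⟩

theorem exists_integerNet_approx {n : ℕ} (hn : 0 < n) {x : EuclideanSpace ℝ (Fin n)}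
    (hx : ‖x‖ = 1) : ∃ m ∈ integerNet n, ∃ y : EuclideanSpace ℝ (Fin n),
      (∀ i, y i = m i / (4 * √n)) ∧ ‖y‖ ≤ 1 ∧ ‖x - y‖ ≤ 1 / 4 := by
  have hn' : (0 : ℝ) < n := by exact_mod_cast hn
  have hs : 0 < √(n : ℝ) := Real.sqrt_pos.2 hn'
  have hs2 : √(n : ℝ) ^ 2 = n := Real.sq_sqrt hn'.le
  choose r hr1 hr2 using exists_int_sq_le_and_sub_sq_le_one
  have hx2 : ∑ i, x i ^ 2 = 1 := by rw [← EuclideanSpace.real_norm_sq_eq, hx, one_pow]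
  have hm : ∑ i, ((r (4 * √n * x i) : ℤ) : ℝ) ^ 2 ≤ 16 * n := by
    calc _ ≤ ∑ i, (4 * √n * x i) ^ 2 := sum_le_sum fun i _ => hr1 _
      _ = 16 * n * ∑ i, x i ^ 2 := by
          rw [mul_sum]; refine sum_congr rfl fun i _ => ?_
          rw [mul_pow, mul_pow, hs2]; ring
      _ = _ := by rw [hx2, mul_one]
  refine ⟨fun i => r (4 * √n * x i), mem_integerNet.2 (by exact_mod_cast hm),
    WithLp.toLp 2 fun i => r (4 * √n * x i) / (4 * √n), fun i => rfl, ?_, ?_⟩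
  · refine le_of_sq_le_sq ?_ zero_le_one
    rw [EuclideanSpace.real_norm_sq_eq]
    simp only [div_pow, mul_pow, hs2, ← sum_div]
    rw [div_le_iff₀ (by positivity)]
    linarith
  · refine le_of_sq_le_sq ?_ (by norm_num)
    rw [EuclideanSpace.real_norm_sq_eq]
    calc _ = ∑ i, (4 * √n * x i - r (4 * √n * x i)) ^ 2 / (16 * n) := by
          refine sum_congr rfl fun i _ => ?_
          rw [show (16 : ℝ) * n = (4 * √n) ^ 2 by rw [mul_pow, hs2]; norm_num, ← div_pow]
          congr 1
          simp only [PiLp.sub_apply]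
          field_simp
      _ ≤ ∑ _i : Fin n, 1 / (16 * (n : ℝ)) := by
          refine sum_le_sum fun i _ => ?_
          gcongr
          exact hr2 _
      _ = _ := by simp; field_simp; norm_num

theorem opNorm_le_of_integerNet {n : ℕ} (hn : 0 < n) {B : Matrix (Fin n) (Fin n) ℝ} {K : ℝ}
    (hK0 : 0 ≤ K) (hK : ∀ a ∈ integerNet n, ∀ b ∈ integerNet n,
      ∑ i, ∑ j, B i j * (a i * b j) ≤ K) : opNorm B ≤ K / (8 * n) := by
  have hn' : (0 : ℝ) < n := by exact_mod_cast hn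
  have hs2 : √(n : ℝ) * √n = n := Real.mul_self_sqrt hn'.le
  have hs : 0 < √(n : ℝ) := Real.sqrt_pos.2 hn'
  unfold opNorm
  set T := LinearMap.toContinuousLinearMap (Matrix.toEuclideanLin B) with hT
  have hinner : ∀ x y : EuclideanSpace ℝ (Fin n),
      (inner ℝ (T x) y : ℝ) = ∑ i, ∑ j, B i j * (y i * x j) := by
    intro x y
    rw [PiLp.inner_apply]
    refine sum_congr rfl fun i _ => ?_
    have : T x i = ∑ j, B i j * x j := rfl
    rw [this]
    simp only [RCLike.inner_apply, conj_trivial, mul_sum]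
    exact sum_congr rfl fun j _ => by ring
  have hmain : ‖T‖ ≤ ‖T‖ / 2 + K / (16 * n) := by
    refine ContinuousLinearMap.opNorm_le_of_re_inner_le (𝕜 := ℝ) (by positivity) fun x y hx hy => ?_
    obtain ⟨b, hb, x', hx', hx1, hxx⟩ := exists_integerNet_approx hn hx
    obtain ⟨a, ha, y', hy', hy1, hyy⟩ := exists_integerNet_approx hn hy
    have e : (inner ℝ (T x) y : ℝ) = inner ℝ (T (x - x')) y + inner ℝ (T x') (y - y') +
        inner ℝ (T x') y' := by
      rw [map_sub, inner_sub_left, inner_sub_right]; ring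
    have e1 : (inner ℝ (T (x - x')) y : ℝ) ≤ ‖T‖ * (1 / 4) := by
      refine (real_inner_le_norm _ _).trans ?_
      rw [hy, mul_one]
      exact T.le_opNorm_of_le hxx
    have e2 : (inner ℝ (T x') (y - y') : ℝ) ≤ ‖T‖ * 1 * (1 / 4) := by
      refine (real_inner_le_norm _ _).trans ?_
      gcongr
      exact T.le_opNorm_of_le hx1
    have e3 : (inner ℝ (T x') y' : ℝ) ≤ K / (16 * n) := by
      have : (inner ℝ (T x') y' : ℝ) = (∑ i, ∑ j, B i j * (a i * b j)) / (16 * n) := by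
        rw [hinner, sum_div]
        refine sum_congr rfl fun i _ => ?_
        rw [sum_div]
        refine sum_congr rfl fun j _ => ?_
        rw [hx', hy', div_mul_div_comm, ← mul_div_assoc]
        congr 1
        linear_combination 16 * hs2
      rw [this]
      gcongr
      exact hK a ha b hb
    change (inner ℝ (T x) y : ℝ) ≤ _
    rw [e]
    linarith
  have : K / (8 * n) = 2 * (K / (16 * n)) := by field_simp; ring
  rw [this]
  linarith

theorem sum_adjMat_le_posRowCount {n : ℕ} {p : Fin n → Fin n → ℝ} {ω : Config n}
    (h1 : ∀ i j, p i j < 1) (i : Fin n) :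
    ∑ j, adjMat ω i j ≤ posRowCount (centeredMat p ω) i := by
  unfold posRowCount
  calc ∑ j, adjMat ω i j = #(univ.filter fun j => adjOf ω i j) := by
        simp [adjMat]
    _ ≤ _ := by
        gcongr with j _
        intro h
        have hij : i ≠ j := by
          rintro rfl
          simp [adjOf] at h
        simp [centeredMat, hij, h, h1 i j]

theorem opNorm_zeroOutRows_le {n : ℕ} (hn : 0 < n) {p : Fin n → Fin n → ℝ}
    (h0 : ∀ i j, 0 ≤ p i j) {σ : ℝ} (hσ : 0 < σ) (hpσ : ∀ i j, p i j ≤ σ ^ 2) {ω : Config n}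
    (hdisc : DiscrepancyBound (σ ^ 2) ω) (hlight : LightBound p (σ * √n) ω) :
    opNorm (zeroOutRows (univ.filter fun i =>
      20 * σ ^ 2 * n < (posRowCount (centeredMat p ω) i : ℝ)) (centeredMat p ω)) ≤
      3440802 * σ * √n := by
  have hn' : (0 : ℝ) < n := by exact_mod_cast hn
  set S := univ.filter fun i => 20 * σ ^ 2 * n < (posRowCount (centeredMat p ω) i : ℝ) with hS
  set D := σ * √n with hD
  have hD0 : 0 < D := mul_pos hσ (Real.sqrt_pos.2 hn')
  have hD2 : D ^ 2 = σ ^ 2 * n := by rw [hD, mul_pow, Real.sq_sqrt hn'.le]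
  have hDn : D ^ 2 / n = σ ^ 2 := by rw [hD2]; field_simp
  have hdeg : ∀ i, i ∉ S → ∑ j, adjMat ω i j ≤ 20 * D ^ 2 := by
    intro i hi
    rw [hD2, ← mul_assoc]
    rcases le_or_gt 1 (σ ^ 2) with h | h
    · calc ∑ j, adjMat ω i j ≤ ∑ _j : Fin n, (1 : ℝ) := by
            refine sum_le_sum fun j _ => ?_
            unfold adjMat; split_ifs <;> norm_num
        _ = 1 * n := by simp
        _ ≤ 20 * σ ^ 2 * n := by gcongr; linarith
    · refine (sum_adjMat_le_posRowCount (fun i j => (hpσ i j).trans_lt h) i).trans ?_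
      simpa [hS] using hi
  have hK : ∀ a ∈ integerNet n, ∀ b ∈ integerNet n,
      ∑ i, ∑ j, zeroOutRows S (centeredMat p ω) i j * (a i * b j) ≤ 27526416 * n * D := by
    intro a ha b hb
    have hmem : ∀ a ∈ integerNet n, (fun i => if i ∈ S then 0 else a i) ∈ integerNet n := by
      intro a ha
      refine mem_integerNet.2 (le_trans (sum_le_sum fun i _ => ?_) (mem_integerNet.1 ha))
      split_ifs
      · simpa using sq_nonneg (a i)
      · exact le_rfl
    have := sum_centeredMat_mul_le hn h0 hD0 (by rwa [hDn]) (by rwa [hDn]) hlight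
      (hmem a ha) (hmem b hb) (fun i hi => hdeg i fun h => hi (if_pos h))
      (fun i hi => hdeg i fun h => hi (if_pos h))
    refine le_trans (le_of_eq ?_) this
    refine sum_congr rfl fun i _ => sum_congr rfl fun j _ => ?_
    by_cases hi : i ∈ S <;> by_cases hj : j ∈ S <;> simp [zeroOutRows, hi, hj]
  refine (opNorm_le_of_integerNet hn (by positivity) hK).trans (le_of_eq ?_)
  rw [hD]; field_simp; norm_num

theorem zeroOutRows_centeredMat_zero {n : ℕ} (ω : Config n) :
    zeroOutRows (univ.filter fun i =>
      0 < (posRowCount (centeredMat (fun _ _ => 0) ω) i : ℝ)) (centeredMat (fun _ _ => 0) ω)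
      = 0 := by
  ext i j
  simp only [zeroOutRows, mem_filter, mem_univ, true_and, Matrix.zero_apply, ite_eq_left_iff,
    not_or]
  rintro ⟨hi, -⟩
  have h : posRowCount (centeredMat (fun _ _ => 0) ω) i = 0 := by
    simpa using hi
  have h' : ¬ 0 < centeredMat (fun _ _ => 0) ω i j := by
    have := filter_eq_empty_iff.1 (card_eq_zero.1 h)
    exact this (mem_univ j)
  refine le_antisymm (not_lt.1 h') ?_
  unfold centeredMat
  split_ifs <;> simp

theorem genMeasure_opNorm_ge {n : ℕ} (hn : 0 < n) {p : Fin n → Fin n → ℝ}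
    (h0 : ∀ i j, 0 ≤ p i j) (h1 : ∀ i j, p i j ≤ 1) (hp : ∀ i j, p i j = p j i) {σ : ℝ}
    (hσ : 0 ≤ σ) (hpσ : ∀ i j, p i j ≤ σ ^ 2) :
    1 - (2 / n + Real.exp (-n)) ≤ (genMeasure p).real {ω | opNorm (zeroOutRows
      (univ.filter fun i => 20 * σ ^ 2 * n < (posRowCount (centeredMat p ω) i : ℝ))
      (centeredMat p ω)) ≤ 3440802 * σ * √n} := by
  have hn' : (0 : ℝ) < n := by exact_mod_cast hn
  rcases hσ.eq_or_lt with rfl | hσ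
  · have hp0 : p = fun _ _ => 0 := by
      ext i j
      exact le_antisymm (by simpa using hpσ i j) (h0 i j)
    have : {ω | opNorm (zeroOutRows
        (univ.filter fun i => 20 * (0 : ℝ) ^ 2 * n < (posRowCount (centeredMat p ω) i : ℝ))
        (centeredMat p ω)) ≤ 3440802 * (0 : ℝ) * √n} = Set.univ := by
      refine Set.eq_univ_of_forall fun ω => ?_
      simp only [Set.mem_ofPred_eq, hp0, ne_eq, OfNat.ofNat_ne_zero, not_false_eq_true, zero_pow,
        mul_zero, zero_mul, zeroOutRows_centeredMat_zero]
      simp [opNorm]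
    rw [this, probReal_univ]
    have : 0 ≤ 2 / (n : ℝ) + Real.exp (-n) := by positivity
    linarith
  · set G := {ω | opNorm (zeroOutRows
      (univ.filter fun i => 20 * σ ^ 2 * n < (posRowCount (centeredMat p ω) i : ℝ))
      (centeredMat p ω)) ≤ 3440802 * σ * √n} with hG
    have hDn : (σ * √n) ^ 2 / n = σ ^ 2 := by
      rw [mul_pow, Real.sq_sqrt hn'.le]; field_simp
    have hsub : Gᶜ ⊆ {ω | ¬ DiscrepancyBound (σ ^ 2) ω} ∪ {ω | ¬ LightBound p (σ * √n) ω} := by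
      intro ω hω
      by_contra h
      simp only [Set.mem_union, Set.mem_ofPred_eq, not_or, not_not] at h
      exact hω (opNorm_zeroOutRows_le hn h0 hσ hpσ h.1 h.2)
    have hc : (genMeasure p).real Gᶜ ≤ 2 / n + Real.exp (-n) :=
      calc _ ≤ _ := measureReal_mono hsub (measure_ne_top _ _)
        _ ≤ _ := measureReal_union_le _ _
        _ ≤ _ := add_le_add
          (genMeasure_not_discrepancyBound_le hn h0 h1 (by positivity) hpσ)
          (genMeasure_not_lightBound_le hn h0 h1 hp (mul_pos hσ (Real.sqrt_pos.2 hn'))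
            (by rwa [hDn]))
    rw [probReal_compl_eq_one_sub (Set.toFinite G).measurableSet] at hc
    linarith

/-- Lemma 3.3 / `cor:sparseNorm`: for the random symmetric matrix `M`
with zero diagonal, independent entries `M_ij = 1 - p_ij` w.p. `p_ij` and `-p_ij`
otherwise, with `p_ij ≤ σ²`, the matrix `M₁` obtained from `M` by zeroing out all rows
and columns with more than `20 σ² n` positive entries satisfies `‖M₁‖ ≤ C σ √n` with
probability `1 - o(1)`. -/
theorem truncated_centered_random_matrix_norm_bound :
    ∃ C : ℝ, 0 < C ∧
      ∀ (p : (n : ℕ) → Fin n → Fin n → ℝ) (σ : ℕ → ℝ),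
        (∀ n i j, 0 ≤ p n i j) → (∀ n i j, p n i j ≤ 1) →
        (∀ n i j, p n i j = p n j i) →
        (∀ n, 0 ≤ σ n) →
        (∀ n i j, p n i j ≤ σ n ^ 2) →
        Tendsto
          (fun n => genMeasure (p n)
            {ω | opNorm
              (zeroOutRows
                (univ.filter fun i =>
                  20 * σ n ^ 2 * n < (posRowCount (centeredMat (p n) ω) i : ℝ))
                (centeredMat (p n) ω)) ≤ C * σ n * Real.sqrt n})
          atTop (nhds 1) := by
  refine ⟨3440802, by norm_num, fun p σ h0 h1 hp hσ hpσ => ?_⟩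
  rw [← ENNReal.tendsto_toReal_iff (fun _ => measure_ne_top _ _) ENNReal.one_ne_top,
    ENNReal.toReal_one]
  have hlim : Tendsto (fun n : ℕ => 1 - (2 / (n : ℝ) + Real.exp (-n))) atTop (nhds 1) := by
    have h2 : Tendsto (fun n : ℕ => Real.exp (-(n : ℝ))) atTop (nhds 0) :=
      Real.tendsto_exp_neg_atTop_nhds_zero.comp tendsto_natCast_atTop_atTop
    simpa using ((tendsto_const_div_atTop_nhds_zero_nat (2 : ℝ)).add h2).const_sub 1
  refine tendsto_of_tendsto_of_tendsto_of_le_of_le' hlim tendsto_const_nhds ?_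
    (Eventually.of_forall fun n => measureReal_le_one)
  filter_upwards [eventually_gt_atTop 0] with n hn
  exact genMeasure_opNorm_ge hn (h0 n) (h1 n) (hp n) (hσ n) (hpσ n)
end

section
/- Let G̃ = (Ṽ, Ẽ) be a graph on n vertices with adjacency matrix Ã, let x, y be unit vectors in ℝⁿ, and let d̃ > 0 be such that: (i) the maximum degree of G̃ is at most c₁·d̃, and (ii) for every pair of vertex subsets S, T ⊆ Ṽ, at least one of the following holds: e(S,T)/(|S||T|·d̃/n) ≤ c₂, or e(S,T)·log(e(S,T)/(|S||T|·d̃/n)) ≤ c₃·|T|·log(n/|T|). Let H := {(i,j) : |x_i·y_j| ≥ √d̃/n} be the set of heavy pairs. Then Σ_{(i,j) ∈ H} x_i·Ã_{ij}·y_j ≤ max(16, 8c₁, 32c₂, 32c₃)·√d̃. -/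
open MeasureTheory Filter Finset

/-- Numerical core of the discrepancy alternative at a pair of dyadic levels `P ≤ q = 2 ^ k * P`:
the rescaled edge count is bounded by a product term plus a term decaying geometrically in `k`. -/
lemma heavy_level_bound {M D N a b e P q r : ℝ} (k : ℕ) (hM : 16 ≤ M) (hD : 8 ≤ D) (hN : 0 < N)
    (ha : 0 < a) (hb : 0 < b) (hP : 0 < P) (hq : q = 2 ^ k * P) (hr : 1 / 2 ≤ r)
    (hrD : (r * D) ^ 2 = P * q)
    (h : e ≤ M / 32 * (a * b * D ^ 2 / N) ∨
      e * Real.log (e / (a * b * D ^ 2 / N)) ≤ M / 32 * b * Real.log (N / b)) :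
    r * e / N ≤ 3 * M / 8 * (a * P / N * (b * q / N)) +
      M / 32 * (5 / 7) ^ k * (b * q / N * (1 / 4 + k / 12) + 1 / (8 * q)) := by
  have hq0 : 0 < q := by rw [hq]; positivity
  have hr0 : 0 < r := by linarith
  have hD0 : 0 < D := by linarith
  have hM0 : 0 < M := by linarith
  set μ := a * b * D ^ 2 / N with hμ
  have hμ0 : 0 < μ := by positivity
  set β := b * q / N with hβ
  have hβ0 : 0 < β := by positivity
  have hαβ : a * P / N * β = r ^ 2 * μ / N := by
    have : a * P / N * β = a * b * (P * q) / N ^ 2 := by rw [hβ]; field_simp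
    rw [this, ← hrD, hμ]; field_simp
  have hextra : 0 ≤ M / 32 * (5 / 7) ^ k * (β * (1 / 4 + k / 12) + 1 / (8 * q)) := by positivity
  rw [hαβ]
  by_cases hc : r * e / N ≤ 3 * M / 8 * (r ^ 2 * μ / N)
  · linarith
  push Not at hc
  have he : 3 * M / 8 * r * μ < e := by
    have h1 : 3 * M / 8 * (r ^ 2 * μ / N) = (r / N) * (3 * M / 8 * r * μ) := by ring
    have h2 : r * e / N = (r / N) * e := by ring
    rw [h1, h2] at hc
    exact lt_of_mul_lt_mul_left hc (by positivity)
  have hlam : 6 * r ≤ e / μ := by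
    rw [le_div_iff₀ hμ0]
    have : 6 * (r * μ) ≤ 3 * M / 8 * (r * μ) := by gcongr; linarith
    linarith
  have h2 : e * Real.log (e / μ) ≤ M / 32 * b * Real.log (N / b) := by
    refine h.resolve_left (not_le.2 (lt_of_le_of_lt ?_ he))
    gcongr
    nlinarith
  set l := Real.log (e / μ) with hl
  have hl3 : Real.log 3 ≤ l := Real.log_le_log (by norm_num) (by linarith)
  have hl6 : Real.log 6 + Real.log r ≤ l := by
    rw [← Real.log_mul (by norm_num) hr0.ne']
    exact Real.log_le_log (by positivity) hlam
  have hlog3 : 1 ≤ Real.log 3 := by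
    rw [Real.le_log_iff_exp_le (by norm_num)]
    exact (Real.exp_one_lt_d9.trans (by norm_num)).le
  have hlog2 : 3 * Real.log 2 ≤ 2 * Real.log 3 := by
    have : Real.log ((2 : ℝ) ^ 3) ≤ Real.log ((3 : ℝ) ^ 2) :=
      Real.log_le_log (by norm_num) (by norm_num)
    rw [Real.log_pow, Real.log_pow] at this
    exact_mod_cast this
  have hl1 : 1 ≤ l := hlog3.trans hl3
  have hlogD : Real.log D ≤ Real.log 6 + 1 / 3 + (D / 8 - 1) := by
    have h1 : Real.log D = Real.log 6 + Real.log (4 / 3) + Real.log (D / 8) := by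
      rw [← Real.log_mul (by norm_num) (by norm_num), ← Real.log_mul (by norm_num) (by positivity)]
      congr 1; ring
    have h3 := Real.log_le_sub_one_of_pos (show (0 : ℝ) < 4 / 3 by norm_num)
    have h4 := Real.log_le_sub_one_of_pos (show 0 < D / 8 by positivity)
    linarith
  have hlogq : 2 * Real.log q = k * Real.log 2 + 2 * Real.log r + 2 * Real.log D := by
    have h1 : q ^ 2 = 2 ^ k * (r * D) ^ 2 := by rw [hrD, hq]; ring
    have h3 := congrArg Real.log h1
    rw [Real.log_mul (by positivity) (by positivity), Real.log_pow, Real.log_pow, Real.log_pow,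
      Real.log_mul hr0.ne' hD0.ne'] at h3
    push_cast at h3
    linarith
  have hNb : N / b = q / β := by rw [hβ]; field_simp
  have hent : β * Real.log (N / b) ≤ β * (2 * Real.log q - 1) + 1 / q := by
    have h1 := Real.log_le_sub_one_of_pos (show 0 < 1 / (q * β) by positivity)
    have h3 : Real.log (N / b) = 2 * Real.log q + Real.log (1 / (q * β)) := by
      rw [hNb, Real.log_div hq0.ne' hβ0.ne', one_div, Real.log_inv,
        Real.log_mul hq0.ne' hβ0.ne']
      ring
    rw [h3]
    calc β * (2 * Real.log q + Real.log (1 / (q * β)))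
        ≤ β * (2 * Real.log q + (1 / (q * β) - 1)) := by gcongr
      _ = β * (2 * Real.log q - 1) + 1 / q := by field_simp; ring
  have hDl : 8 * l ≤ D * l := by gcongr
  have hmain : 2 * Real.log q - 1 ≤ D * l * (1 / 4 + k / 12) := by
    have h1 : 0 ≤ (D / 4 - 2) * (l - 1) := mul_nonneg (by linarith) (by linarith)
    have h3 : (k : ℝ) * Real.log 2 ≤ k * (D * l / 12) := by gcongr; linarith
    rw [hlogq]
    linarith
  have hq1 : 1 / q ≤ D * l * (1 / (8 * q)) := by
    have : 1 / q = 8 * (1 / (8 * q)) := by field_simp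
    rw [this]
    gcongr
    linarith
  have hgeo : r * D / q ≤ (5 / 7) ^ k := by
    refine le_of_sq_le_sq ?_ (by positivity)
    have h1 : (r * D / q) ^ 2 = (1 / 2) ^ k := by
      rw [div_pow, hrD, hq, div_pow, one_pow]; field_simp
    rw [h1, ← pow_mul, mul_comm k 2, pow_mul]
    gcongr
    norm_num
  set B := β * (1 / 4 + (k : ℝ) / 12) + 1 / (8 * q) with hB
  have hB0 : 0 ≤ B := by positivity
  have hβB : β * Real.log (N / b) ≤ D * l * B := by
    have h1 : β * (2 * Real.log q - 1) ≤ β * (D * l * (1 / 4 + k / 12)) := by gcongr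
    rw [hB]
    linarith
  have hfin : r * e / N * l ≤ M / 32 * (5 / 7) ^ k * B * l := by
    calc r * e / N * l = r / N * (e * l) := by ring
      _ ≤ r / N * (M / 32 * b * Real.log (N / b)) := by gcongr
      _ = M / 32 * (r / q) * (β * Real.log (N / b)) := by rw [hβ]; field_simp
      _ ≤ M / 32 * (r / q) * (D * l * B) := by gcongr
      _ = M / 32 * (r * D / q) * B * l := by ring
      _ ≤ M / 32 * (5 / 7) ^ k * B * l := by gcongr
  have h5 : r * e / N ≤ M / 32 * (5 / 7) ^ k * B := le_of_mul_le_mul_right hfin (by linarith)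
  have h6 : 0 ≤ 3 * M / 8 * (r ^ 2 * μ / N) := by positivity
  linarith

/-- Partial sums over integers at most `j`, indexed by the gap to `j`, are bounded by the full
series over the gaps. -/
lemma sum_filter_le_of_hasSum_gap {f : ℕ → ℝ} {s : ℝ} (hf : ∀ k, 0 ≤ f k) (hs : HasSum f s)
    (F : Finset ℤ) (j : ℤ) : ∑ i ∈ F with i ≤ j, f (j - i).toNat ≤ s := by
  have hinj : Set.InjOn (fun i : ℤ => (j - i).toNat) (F.filter (· ≤ j)) := by
    intro a ha b hb hab
    rw [Finset.mem_coe, mem_filter] at ha hb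
    simp only at hab
    omega
  rw [← Finset.sum_image (f := f) hinj]
  exact sum_le_hasSum _ (fun k _ => hf k) hs

lemma hasSum_level_weight :
    HasSum (fun k : ℕ => (5 / 7 : ℝ) ^ k * (1 / 4 + k / 12)) (77 / 48) := by
  have h1 := (hasSum_geometric_of_lt_one (r := (5 / 7 : ℝ)) (by norm_num) (by norm_num)).mul_left
    (1 / 4)
  have h2 := (hasSum_coe_mul_geometric_of_norm_lt_one (r := (5 / 7 : ℝ))
    (by norm_num [abs_lt])).mul_left (1 / 12)
  have h3 : (1 / 4 * (1 - 5 / 7)⁻¹ + 1 / 12 * (5 / 7 / (1 - 5 / 7) ^ 2) : ℝ) = 77 / 48 := by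
    norm_num
  have h4 : (fun k : ℕ => (5 / 7 : ℝ) ^ k * (1 / 4 + k / 12)) =
      fun k : ℕ => 1 / 4 * (5 / 7) ^ k + 1 / 12 * ((k : ℝ) * (5 / 7) ^ k) := by
    ext k; ring
  rw [h4, ← h3]
  exact h1.add h2

/-- Summing the geometrically decaying terms of `heavy_level_bound` over all pairs of levels. -/
lemma sum_level_terms_le (F F' : Finset ℤ) (β : ℤ → ℝ) (hβ : ∀ j, 0 ≤ β j)
    (hsum : ∑ j ∈ F', β j ≤ 1) :
    ∑ j ∈ F' with 2 ≤ j, ∑ i ∈ F with i ≤ j, (5 / 7 : ℝ) ^ (j - i).toNat *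
      (β j * (1 / 4 + ((j - i).toNat : ℝ) / 12) + 1 / (8 * 2 ^ j)) ≤ 2 := by
  have hinner : ∀ j : ℤ, ∑ i ∈ F with i ≤ j, (5 / 7 : ℝ) ^ (j - i).toNat *
      (β j * (1 / 4 + ((j - i).toNat : ℝ) / 12) + 1 / (8 * 2 ^ j)) ≤
      β j * (77 / 48) + 7 / 16 * (2 ^ j)⁻¹ := by
    intro j
    have h1 := sum_filter_le_of_hasSum_gap (fun k => by positivity) hasSum_level_weight F j
    have h2 := sum_filter_le_of_hasSum_gap (fun k => by positivity)
      (hasSum_geometric_of_lt_one (r := (5 / 7 : ℝ)) (by norm_num) (by norm_num)) F j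
    calc _ = β j * (∑ i ∈ F with i ≤ j, (5 / 7 : ℝ) ^ (j - i).toNat *
            (1 / 4 + ((j - i).toNat : ℝ) / 12)) +
          1 / 8 * (2 ^ j)⁻¹ * ∑ i ∈ F with i ≤ j, (5 / 7 : ℝ) ^ (j - i).toNat := by
          rw [Finset.mul_sum, Finset.mul_sum, ← Finset.sum_add_distrib]
          refine Finset.sum_congr rfl fun i _ => ?_
          rw [one_div (8 * (2 : ℝ) ^ j), mul_inv]
          ring
      _ ≤ β j * (77 / 48) + 1 / 8 * (2 ^ j)⁻¹ * (1 - 5 / 7)⁻¹ := by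
          have := hβ j
          gcongr
      _ = _ := by norm_num; ring
  have hgeo : ∑ j ∈ F' with 2 ≤ j, ((2 : ℝ) ^ j)⁻¹ ≤ 1 / 2 := by
    have hs : HasSum (fun k : ℕ => (1 / 4 : ℝ) * (1 / 2) ^ k) (1 / 2) := by
      have h3 : (1 / 2 : ℝ) = 1 / 4 * (1 - 1 / 2)⁻¹ := by norm_num
      have h4 := (hasSum_geometric_of_lt_one (r := (1 / 2 : ℝ)) (by norm_num)
        (by norm_num)).mul_left (1 / 4)
      rwa [← h3] at h4
    have hinj : Set.InjOn (fun i : ℤ => (i - 2).toNat) (F'.filter (2 ≤ ·)) := by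
      intro a ha b hb hab
      rw [Finset.mem_coe, mem_filter] at ha hb
      simp only at hab
      omega
    refine le_trans (le_of_eq ?_) (sum_le_hasSum ((F'.filter (2 ≤ ·)).image
      fun i : ℤ => (i - 2).toNat) (fun k _ => by positivity) hs)
    rw [Finset.sum_image hinj]
    refine Finset.sum_congr rfl fun j hj => ?_
    obtain ⟨m, rfl⟩ : ∃ m : ℕ, j = m + 2 := ⟨(j - 2).toNat, by have := (mem_filter.1 hj).2; omega⟩
    have : ((m : ℤ) + 2 - 2).toNat = m := by omega
    rw [this, zpow_add₀ (by norm_num), zpow_natCast, mul_inv, one_div_pow]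
    norm_num
    ring
  have hβs : ∑ j ∈ F' with 2 ≤ j, β j ≤ 1 :=
    (Finset.sum_le_sum_of_subset_of_nonneg (filter_subset _ _) fun j _ _ => hβ j).trans hsum
  calc _ ≤ ∑ j ∈ F' with 2 ≤ j, (β j * (77 / 48) + 7 / 16 * (2 ^ j)⁻¹) :=
        Finset.sum_le_sum fun j _ => hinner j
    _ = (∑ j ∈ F' with 2 ≤ j, β j) * (77 / 48) + 7 / 16 * ∑ j ∈ F' with 2 ≤ j, ((2 : ℝ) ^ j)⁻¹ := by
        rw [Finset.sum_add_distrib, Finset.sum_mul, Finset.mul_sum]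
    _ ≤ 2 := by linarith

/-- The bilinear form of the adjacency matrix on unit vectors is at most the maximum degree. -/
lemma sum_abs_adj_le {n : ℕ} (G : SimpleGraph (Fin n)) [DecidableRel G.Adj]
    (x y : Fin n → ℝ) (hx : ∑ i, x i ^ 2 = 1) (hy : ∑ i, y i ^ 2 = 1) {B : ℝ}
    (hdeg : ∀ v, (G.degree v : ℝ) ≤ B) :
    ∑ p : Fin n × Fin n, |x p.1| * (if G.Adj p.1 p.2 then 1 else 0) * |y p.2| ≤ B := by
  have hrow : ∀ u, ∑ v, (if G.Adj u v then (1 : ℝ) else 0) ≤ B := fun u => by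
    rw [Finset.sum_boole, ← SimpleGraph.neighborFinset_eq_filter]
    exact hdeg u
  have hmass : ∀ z : Fin n → ℝ, ∑ i, z i ^ 2 = 1 →
      ∑ u, z u ^ 2 * ∑ v, (if G.Adj u v then (1 : ℝ) else 0) ≤ B := fun z hz => by
    calc _ ≤ ∑ u, z u ^ 2 * B := by
          gcongr with u
          exact hrow u
      _ = B := by rw [← Finset.sum_mul, hz, one_mul]
  rw [Fintype.sum_prod_type]
  calc ∑ u, ∑ v, |x u| * (if G.Adj u v then 1 else 0) * |y v|
      ≤ ∑ u, ∑ v, (x u ^ 2 * (if G.Adj u v then 1 else 0) / 2 +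
          y v ^ 2 * (if G.Adj u v then 1 else 0) / 2) := by
        refine Finset.sum_le_sum fun u _ => Finset.sum_le_sum fun v _ => ?_
        split_ifs
        · nlinarith [sq_nonneg (|x u| - |y v|), sq_abs (x u), sq_abs (y v)]
        · simp
    _ = (∑ u, x u ^ 2 * ∑ v, (if G.Adj u v then (1 : ℝ) else 0)) / 2 +
          (∑ v, y v ^ 2 * ∑ u, (if G.Adj v u then (1 : ℝ) else 0)) / 2 := by
        simp_rw [Finset.sum_add_distrib]
        congr 1
        · simp_rw [Finset.mul_sum, Finset.sum_div]
        · rw [Finset.sum_comm]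
          simp_rw [Finset.mul_sum, Finset.sum_div, G.adj_comm]
    _ ≤ B := by linarith [hmass x hx, hmass y hy]

lemma eCount_comm {n : ℕ} (G : SimpleGraph (Fin n)) [DecidableRel G.Adj]
    (S T : Finset (Fin n)) : eCount G S T = eCount G T S := by
  unfold eCount
  rw [Finset.sum_comm]
  simp_rw [G.adj_comm]

/-- The dyadic level of `u`: the indices where `n * x u ^ 2` lies in `[2 ^ i, 2 ^ (i + 1))`. -/
noncomputable def dyadicLevel {n : ℕ} (x : Fin n → ℝ) (i : ℤ) : Finset (Fin n) :=
  {u ∈ ({u | x u ≠ 0} : Finset (Fin n)) | Int.log 2 ((n : ℝ) * x u ^ 2) = i}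

/-- The indices of the dyadic levels which occur in `x`. -/
noncomputable def dyadicIndices {n : ℕ} (x : Fin n → ℝ) : Finset ℤ :=
  univ.image fun u => Int.log 2 ((n : ℝ) * x u ^ 2)

lemma sum_dyadicLevel {n : ℕ} (x : Fin n → ℝ) (f : Fin n → ℝ) :
    ∑ i ∈ dyadicIndices x, ∑ u ∈ dyadicLevel x i, f u = ∑ u with x u ≠ 0, f u :=
  Finset.sum_fiberwise_of_maps_to (fun _ _ => mem_image_of_mem _ (mem_univ _)) _

lemma mem_dyadicLevel {n : ℕ} {x : Fin n → ℝ} {i : ℤ} {u : Fin n} :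
    u ∈ dyadicLevel x i ↔ x u ≠ 0 ∧ Int.log 2 ((n : ℝ) * x u ^ 2) = i := by
  simp [dyadicLevel]

lemma sum_dyadicLevel_mass_le {n : ℕ} (hn : 0 < n) (x : Fin n → ℝ) (hx : ∑ i, x i ^ 2 = 1) :
    ∑ i ∈ dyadicIndices x, ((dyadicLevel x i).card : ℝ) * 2 ^ i / n ≤ 1 := by
  have hN : (0 : ℝ) < n := by exact_mod_cast hn
  calc _ ≤ ∑ i ∈ dyadicIndices x, ∑ u ∈ dyadicLevel x i, x u ^ 2 := by
        refine Finset.sum_le_sum fun i _ => ?_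
        rw [mul_div_assoc, ← nsmul_eq_mul]
        refine Finset.card_nsmul_le_sum _ _ _ fun u hu => ?_
        obtain ⟨hu0, rfl⟩ := mem_dyadicLevel.1 hu
        rw [div_le_iff₀ hN, mul_comm (x u ^ 2)]
        have hpos : 0 < (n : ℝ) * x u ^ 2 := by positivity
        exact_mod_cast Int.zpow_log_le_self (b := 2) (by norm_num) hpos
    _ = ∑ u with x u ≠ 0, x u ^ 2 := sum_dyadicLevel x _
    _ ≤ ∑ u, x u ^ 2 :=
        Finset.sum_le_sum_of_subset_of_nonneg (filter_subset _ _) fun _ _ _ => sq_nonneg _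
    _ = 1 := hx

/-- Heavy pairs grouped by dyadic levels. -/
lemma sum_heavy_le_sum_levels {n : ℕ} (hn : 0 < n) (G : SimpleGraph (Fin n)) [DecidableRel G.Adj]
    (x y : Fin n → ℝ) {D : ℝ} (hD : 0 < D) :
    ∑ p ∈ univ.filter (fun p : Fin n × Fin n => D / n ≤ |x p.1 * y p.2|),
        x p.1 * (if G.Adj p.1 p.2 then 1 else 0) * y p.2 ≤
      ∑ i ∈ dyadicIndices x, ∑ j ∈ dyadicIndices y,
        (if 1 / 2 ≤ √(2 ^ i * 2 ^ j) / D then 2 * D * (√(2 ^ i * 2 ^ j) / D *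
          eCount G (dyadicLevel x i) (dyadicLevel y j) / n) else 0) := by
  have hN : (0 : ℝ) < n := by exact_mod_cast hn
  set w : ℤ → ℤ → ℝ := fun i j =>
    if 1 / 2 ≤ √(2 ^ i * 2 ^ j) / D then 2 * √(2 ^ i * 2 ^ j) / n else 0 with hw
  set I : Fin n → ℤ := fun u => Int.log 2 ((n : ℝ) * x u ^ 2) with hI
  set J : Fin n → ℤ := fun v => Int.log 2 ((n : ℝ) * y v ^ 2) with hJ
  have hw0 : ∀ i j, 0 ≤ w i j := fun i j => by
    simp only [hw]; split_ifs <;> positivity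
  have hpair : ∀ u v, D / n ≤ |x u * y v| → x u ≠ 0 → y v ≠ 0 → |x u * y v| ≤ w (I u) (J v) := by
    intro u v h hu hv
    have h1 := Int.lt_zpow_succ_log_self (b := 2) (by norm_num) ((n : ℝ) * x u ^ 2)
    have h2 := Int.lt_zpow_succ_log_self (b := 2) (by norm_num) ((n : ℝ) * y v ^ 2)
    have hle : n * |x u * y v| ≤ 2 * √(2 ^ I u * 2 ^ J v) := by
      rw [show (2 : ℝ) = √4 by rw [show (4 : ℝ) = 2 ^ 2 by norm_num]; simp,
        ← Real.sqrt_mul (by norm_num)]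
      refine Real.le_sqrt_of_sq_le ?_
      rw [show √4 = (2 : ℝ) by rw [show (4 : ℝ) = 2 ^ 2 by norm_num]; simp]
      calc (n * |x u * y v|) ^ 2 = (n * x u ^ 2) * (n * y v ^ 2) := by
            rw [mul_pow, sq_abs]; ring
        _ ≤ (2 : ℝ) ^ (I u + 1) * 2 ^ (J v + 1) := by
            gcongr
            · exact_mod_cast h1.le
            · exact_mod_cast h2.le
        _ = 4 * (2 ^ I u * 2 ^ J v) := by
            rw [zpow_add_one₀ (by norm_num), zpow_add_one₀ (by norm_num)]; ring
    have hr : 1 / 2 ≤ √(2 ^ I u * 2 ^ J v) / D := by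
      rw [div_le_iff₀ hN] at h
      rw [le_div_iff₀ hD]
      linarith
    simp only [hw, if_pos hr]
    rw [le_div_iff₀ hN]
    linarith
  calc _ ≤ ∑ p : Fin n × Fin n, (if x p.1 ≠ 0 then (if y p.2 ≠ 0 then
          w (I p.1) (J p.2) * (if G.Adj p.1 p.2 then 1 else 0) else 0) else 0) := by
        rw [Finset.sum_filter]
        refine Finset.sum_le_sum fun p _ => ?_
        have := hw0 (I p.1) (J p.2)
        by_cases hu : x p.1 = 0
        · simp [hu]
        by_cases hv : y p.2 = 0
        · simp [hv]
        simp only [ne_eq, hu, hv, not_false_eq_true, if_true]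
        split_ifs with h1 h2
        · have := (le_abs_self _).trans (hpair p.1 p.2 h1 hu hv)
          linarith
        · simp
        · linarith
        · simp
    _ = ∑ u with x u ≠ 0, ∑ v with y v ≠ 0, w (I u) (J v) * (if G.Adj u v then 1 else 0) := by
        rw [Fintype.sum_prod_type, Finset.sum_filter]
        refine Finset.sum_congr rfl fun u _ => ?_
        rw [Finset.sum_filter]
        split_ifs <;> simp
    _ = ∑ i ∈ dyadicIndices x, ∑ u ∈ dyadicLevel x i, ∑ j ∈ dyadicIndices y,
          ∑ v ∈ dyadicLevel y j, w (I u) (J v) * (if G.Adj u v then 1 else 0) := by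
        simp_rw [sum_dyadicLevel]
    _ = ∑ i ∈ dyadicIndices x, ∑ j ∈ dyadicIndices y,
          w i j * eCount G (dyadicLevel x i) (dyadicLevel y j) := by
        refine Finset.sum_congr rfl fun i _ => ?_
        rw [Finset.sum_comm]
        refine Finset.sum_congr rfl fun j _ => ?_
        rw [eCount, Finset.mul_sum]
        refine Finset.sum_congr rfl fun u hu => ?_
        rw [Finset.mul_sum]
        refine Finset.sum_congr rfl fun v hv => ?_
        rw [← (mem_dyadicLevel.1 hu).2, ← (mem_dyadicLevel.1 hv).2]
    _ = _ := by
        refine Finset.sum_congr rfl fun i _ => Finset.sum_congr rfl fun j _ => ?_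
        simp only [hw]
        split_ifs
        · field_simp
        · simp

/-- `heavy_level_bound` for a pair of vertex sets attached to integer levels `i ≤ j`. -/
lemma eCount_level_bound {n : ℕ} (G : SimpleGraph (Fin n)) [DecidableRel G.Adj] {M D : ℝ}
    (hn : 0 < n) (hM : 16 ≤ M) (hD : 8 ≤ D) (S T : Finset (Fin n)) {i j : ℤ} (hij : i ≤ j)
    (hr : 1 / 2 ≤ √(2 ^ i * 2 ^ j) / D)
    (h : eCount G S T ≤ M / 32 * ((S.card : ℝ) * T.card * D ^ 2 / n) ∨
      eCount G S T * Real.log (eCount G S T / ((S.card : ℝ) * T.card * D ^ 2 / n)) ≤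
        M / 32 * T.card * Real.log ((n : ℝ) / T.card)) :
    2 ≤ j ∧ √(2 ^ i * 2 ^ j) / D * eCount G S T / n ≤
      3 * M / 8 * ((S.card : ℝ) * 2 ^ i / n * (T.card * 2 ^ j / n)) +
      M / 32 * ((5 / 7) ^ (j - i).toNat *
        (T.card * 2 ^ j / n * (1 / 4 + ((j - i).toNat : ℝ) / 12) + 1 / (8 * 2 ^ j))) := by
  have hN : (0 : ℝ) < n := by exact_mod_cast hn
  have hD0 : 0 < D := by linarith
  have hrD : (√(2 ^ i * 2 ^ j) / D * D) ^ 2 = (2 : ℝ) ^ i * 2 ^ j := by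
    rw [div_mul_cancel₀ _ hD0.ne', Real.sq_sqrt (by positivity)]
  constructor
  · by_contra! hj
    have h1 : (2 : ℝ) ^ i ≤ 2 ^ (1 : ℤ) := zpow_le_zpow_right₀ (by norm_num) (by omega)
    have h2 : (2 : ℝ) ^ j ≤ 2 ^ (1 : ℤ) := zpow_le_zpow_right₀ (by norm_num) (by omega)
    have h3 : (2 : ℝ) ^ i * 2 ^ j ≤ 2 ^ (1 : ℤ) * 2 ^ (1 : ℤ) := by gcongr
    have h4 : 4 ≤ √(2 ^ i * 2 ^ j) / D * D := by nlinarith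
    norm_num at h3
    nlinarith
  rcases S.eq_empty_or_nonempty with rfl | hS
  · simp only [eCount, Finset.sum_empty, mul_zero, zero_div]
    positivity
  rcases T.eq_empty_or_nonempty with rfl | hT
  · simp only [eCount, Finset.sum_empty, Finset.sum_const_zero, mul_zero, zero_div]
    positivity
  have hq : (2 : ℝ) ^ j = 2 ^ (j - i).toNat * 2 ^ i := by
    rw [← zpow_natCast, ← zpow_add₀ (by norm_num)]
    congr 1
    omega
  have := heavy_level_bound (j - i).toNat hM hD hN (by exact_mod_cast hS.card_pos)
    (by exact_mod_cast hT.card_pos) (by positivity) hq hr hrD h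
  rwa [mul_assoc (M / 32)] at this

/-- The geometrically decaying term attached to levels `2 ≤ j`, `i ≤ j` with mass `b` at level `j`,
and zero at all other pairs of levels. -/
noncomputable def levelTerm (b : ℝ) (i j : ℤ) : ℝ :=
  if 2 ≤ j then if i ≤ j then
    (5 / 7 : ℝ) ^ (j - i).toNat * (b * (1 / 4 + ((j - i).toNat : ℝ) / 12) + 1 / (8 * 2 ^ j))
  else 0 else 0

lemma levelTerm_nonneg {b : ℝ} (hb : 0 ≤ b) (i j : ℤ) : 0 ≤ levelTerm b i j := by
  unfold levelTerm
  split_ifs <;> positivity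

lemma sum_levelTerm_le (F F' : Finset ℤ) (β : ℤ → ℝ) (hβ : ∀ j, 0 ≤ β j)
    (hsum : ∑ j ∈ F', β j ≤ 1) : ∑ j ∈ F', ∑ i ∈ F, levelTerm (β j) i j ≤ 2 := by
  refine le_trans (le_of_eq ?_) (sum_level_terms_le F F' β hβ hsum)
  rw [Finset.sum_filter]
  refine Finset.sum_congr rfl fun j _ => ?_
  simp only [levelTerm]
  rw [Finset.sum_filter]
  split_ifs <;> simp

/-- A quantity dominated by product terms and level terms at each pair of levels. -/
lemma sum_sum_le_of_levelTerm {F F' : Finset ℤ} {α β : ℤ → ℝ} (hα : ∀ i, 0 ≤ α i)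
    (hβ : ∀ j, 0 ≤ β j) (hαs : ∑ i ∈ F, α i ≤ 1) (hβs : ∑ j ∈ F', β j ≤ 1) {E : ℤ → ℤ → ℝ}
    {A B : ℝ} (hA : 0 ≤ A) (hB : 0 ≤ B)
    (hE : ∀ i j, E i j ≤ A * (α i * β j) + B * (levelTerm (β j) i j + levelTerm (α i) j i)) :
    ∑ i ∈ F, ∑ j ∈ F', E i j ≤ A + 4 * B := by
  calc _ ≤ ∑ i ∈ F, ∑ j ∈ F',
        (A * (α i * β j) + B * (levelTerm (β j) i j + levelTerm (α i) j i)) :=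
        Finset.sum_le_sum fun i _ => Finset.sum_le_sum fun j _ => hE i j
    _ = A * ((∑ i ∈ F, α i) * ∑ j ∈ F', β j) + B * (∑ j ∈ F', ∑ i ∈ F, levelTerm (β j) i j +
          ∑ i ∈ F, ∑ j ∈ F', levelTerm (α i) j i) := by
        rw [Finset.sum_mul_sum, Finset.sum_comm (s := F')]
        simp only [Finset.mul_sum, Finset.sum_add_distrib, mul_add]
    _ ≤ A * (1 * 1) + B * (2 + 2) := by
        gcongr
        · exact Finset.sum_nonneg fun j _ => hβ j
        · exact sum_levelTerm_le _ _ β hβ hβs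
        · exact sum_levelTerm_le _ _ α hα hαs
    _ = A + 4 * B := by ring

/-- The discrepancy alternative bounds the contribution of heavy pairs once `√d ≥ 8`. -/
lemma sum_heavy_le_of_discrepancy {n : ℕ} (hn : 0 < n) (G : SimpleGraph (Fin n))
    [DecidableRel G.Adj] (x y : Fin n → ℝ) (hx : ∑ i, x i ^ 2 = 1) (hy : ∑ i, y i ^ 2 = 1)
    {M D : ℝ} (hM : 16 ≤ M) (hD : 8 ≤ D)
    (hdisc : ∀ S T : Finset (Fin n),
      eCount G S T ≤ M / 32 * ((S.card : ℝ) * T.card * D ^ 2 / n) ∨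
      eCount G S T * Real.log (eCount G S T / ((S.card : ℝ) * T.card * D ^ 2 / n)) ≤
        M / 32 * T.card * Real.log ((n : ℝ) / T.card)) :
    ∑ p ∈ univ.filter (fun p : Fin n × Fin n => D / n ≤ |x p.1 * y p.2|),
        x p.1 * (if G.Adj p.1 p.2 then 1 else 0) * y p.2 ≤ M * D := by
  have hD0 : 0 < D := by linarith
  have hM0 : 0 < M := by linarith
  have hN : (0 : ℝ) < n := by exact_mod_cast hn
  have hmass0 : ∀ (z : Fin n → ℝ) (i : ℤ), 0 ≤ ((dyadicLevel z i).card : ℝ) * 2 ^ i / n :=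
    fun z i => by positivity
  refine (sum_heavy_le_sum_levels hn G x y hD0).trans ?_
  refine (sum_sum_le_of_levelTerm (A := 2 * D * (3 * M / 8)) (B := 2 * D * (M / 32)) (hmass0 x)
    (hmass0 y) (sum_dyadicLevel_mass_le hn x hx) (sum_dyadicLevel_mass_le hn y hy) (by positivity)
    (by positivity) fun i j => ?_).trans_eq (by ring)
  have h1 := levelTerm_nonneg (hmass0 y j) i j
  have h2 := levelTerm_nonneg (hmass0 x i) j i
  have h3 := mul_nonneg (hmass0 x i) (hmass0 y j)
  rw [mul_assoc (2 * D), mul_assoc (2 * D), ← mul_add, mul_add (M / 32)]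
  split_ifs with hr
  · refine mul_le_mul_of_nonneg_left ?_ (by positivity)
    rcases le_total i j with hij | hij
    · obtain ⟨hj, hb⟩ := eCount_level_bound G hn hM hD _ _ hij hr
        (hdisc (dyadicLevel x i) (dyadicLevel y j))
      rw [levelTerm, if_pos hj, if_pos hij]
      linarith [mul_nonneg hM0.le h2]
    · obtain ⟨hi, hb⟩ := eCount_level_bound G hn hM hD _ _ hij
        (by rwa [mul_comm ((2 : ℝ) ^ j)]) (hdisc (dyadicLevel y j) (dyadicLevel x i))
      rw [eCount_comm, mul_comm ((2 : ℝ) ^ j), mul_comm (_ / (n : ℝ)) (_ / (n : ℝ))] at hb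
      rw [levelTerm.eq_def _ j i, if_pos hi, if_pos hij]
      linarith [mul_nonneg hM0.le h1]
  · positivity

/-- Lemma A.5 / `lem:FE_heavy`: for a graph of maximum degree at
most `c₁ d̃` satisfying the discrepancy alternative for all vertex subsets, and unit
vectors `x, y`, the contribution of the heavy pairs
`H = {(i,j) : |x_i y_j| ≥ √d̃/n}` satisfies
`Σ_H x_i Ã_{ij} y_j ≤ max(16, 8c₁, 32c₂, 32c₃) √d̃`. -/
theorem heavy_pairs_contribution_bound
    (n : ℕ) (G : SimpleGraph (Fin n)) [DecidableRel G.Adj]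
    (x y : Fin n → ℝ) (hx : ∑ i, x i ^ 2 = 1) (hy : ∑ i, y i ^ 2 = 1)
    (d c₁ c₂ c₃ : ℝ) (hd : 0 < d) (hc₁ : 0 < c₁) (hc₂ : 0 < c₂) (hc₃ : 0 < c₃)
    (hdeg : ∀ v, (G.degree v : ℝ) ≤ c₁ * d)
    (hdisc : ∀ S T : Finset (Fin n),
      eCount G S T ≤ c₂ * ((S.card : ℝ) * T.card * d / n) ∨
      eCount G S T * Real.log (eCount G S T / ((S.card : ℝ) * T.card * d / n)) ≤
        c₃ * T.card * Real.log ((n : ℝ) / T.card)) :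
    ∑ p ∈ univ.filter (fun p : Fin n × Fin n => Real.sqrt d / n ≤ |x p.1 * y p.2|),
        x p.1 * (if G.Adj p.1 p.2 then 1 else 0) * y p.2 ≤
      max (max 16 (8 * c₁)) (max (32 * c₂) (32 * c₃)) * Real.sqrt d := by
  have hn : 0 < n := Nat.pos_of_ne_zero fun h => by subst h; simp at hx
  set M := max (max 16 (8 * c₁)) (max (32 * c₂) (32 * c₃)) with hMdef
  have hM16 : 16 ≤ M := (le_max_left _ _).trans (le_max_left _ _)
  have hM1 : 8 * c₁ ≤ M := (le_max_right _ _).trans (le_max_left _ _)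
  have hM2 : 32 * c₂ ≤ M := (le_max_left _ _).trans (le_max_right _ _)
  have hM3 : 32 * c₃ ≤ M := (le_max_right _ _).trans (le_max_right _ _)
  have hd2 : √d ^ 2 = d := Real.sq_sqrt hd.le
  have hd0 : 0 < √d := Real.sqrt_pos.2 hd
  rcases le_total (√d) 8 with h8 | h8
  · calc _ ≤ ∑ p : Fin n × Fin n, |x p.1| * (if G.Adj p.1 p.2 then 1 else 0) * |y p.2| := by
          refine le_trans (Finset.sum_le_sum fun p _ => ?_)
            (Finset.sum_le_sum_of_subset_of_nonneg (filter_subset _ _) fun p _ _ => by positivity)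
          split_ifs
          · rw [mul_one, mul_one, ← abs_mul]
            exact le_abs_self _
          · simp
      _ ≤ c₁ * d := sum_abs_adj_le G x y hx hy hdeg
      _ = c₁ * √d * √d := by rw [mul_assoc, ← sq, hd2]
      _ ≤ M * √d := by gcongr; nlinarith
  · refine sum_heavy_le_of_discrepancy hn G x y hx hy hM16 h8 fun S T => ?_
    rw [hd2]
    refine (hdisc S T).imp (fun h => h.trans ?_) fun h => h.trans ?_
    · gcongr
      linarith
    · have : 0 ≤ Real.log ((n : ℝ) / T.card) := by
        rcases T.eq_empty_or_nonempty with rfl | hT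
        · simp
        refine Real.log_nonneg ((one_le_div (by exact_mod_cast hT.card_pos)).2 ?_)
        exact_mod_cast (card_le_univ T).trans_eq (Fintype.card_fin n)
      gcongr
      linarith
end
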